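/- arXiv:math/0301343 — 10 statements merged into one kernel-verified Lean document; each statement's English description precedes it below -/
import Mathlib

section
/- For every δ > 0 there exist ε > 0 and c > 0 with the following property: for every prime q, setting F = ℤ/qℤ, and every subset A of F satisfying |F|^δ < |A| < |F|^{1-δ}, one has max(|A+A|, |A·A|) ≥ c·|A|^{1+ε}. -/
open Pointwise

open Finset in
/-- The number of coincidences of a map is bounded below by Cauchy–Schwarz. -/
theorem card_sq_le_card_image_mul_card_coincidences {α β : Type*} [DecidableEq α] [DecidableEq β]
    (P : Finset α) (f : α → β) :
    #P ^ 2 ≤ #(P.image f) * #{z ∈ P ×ˢ P | f z.1 = f z.2} := by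
  have h₁ : #P = ∑ t ∈ P.image f, #{p ∈ P | f p = t} :=
    card_eq_sum_card_fiberwise fun p hp => mem_image_of_mem f hp
  have h₂ : #{z ∈ P ×ˢ P | f z.1 = f z.2} = ∑ t ∈ P.image f, #{p ∈ P | f p = t} ^ 2 := by
    rw [card_eq_sum_card_fiberwise (f := fun z => f z.1) (t := P.image f)
      fun z hz => mem_image_of_mem f (mem_product.1 (mem_filter.1 hz).1).1]
    refine sum_congr rfl fun t _ => ?_
    rw [sq, ← card_product]
    congr 1
    ext z
    simp only [mem_filter, mem_product]
    grind
  rw [h₂]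
  nth_rewrite 1 [h₁]
  exact sq_sum_le_card_mul_sum_sq

section Dilates

open Finset

variable {F : Type*} [Field F] [DecidableEq F]

/-- The sum of `A` and its dilate `x • A` has size at most `M * #A`. -/
def SmallDilateSum (A : Finset F) (M : ℝ) (x : F) : Prop :=
  (#(A + x • A) : ℝ) ≤ M * #A

theorem ruzsa_triangle_real (U W V : Finset F) :
    (#(U + V) : ℝ) * #W ≤ #(U + W) * #(W + V) := by
  exact_mod_cast ruzsa_triangle_inequality_add_add_add U W V

theorem card_smul_add_smul {x : F} (hx : x ≠ 0) (U V : Finset F) :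
    #(x • U + x • V) = #(U + V) := by
  rw [← smul_add, card_smul_finset₀ hx]

namespace SmallDilateSum

variable {A : Finset F} {K M N : ℝ} {x y : F}

theorem mono (hx : SmallDilateSum A M x) (hMN : M ≤ N) : SmallDilateSum A N x :=
  le_trans hx (by gcongr)

theorem zero (hA : A.Nonempty) (hM : 1 ≤ M) : SmallDilateSum A M 0 := by
  have : (0 : ℝ) ≤ #A := by positivity
  simp only [SmallDilateSum, zero_smul_finset hA, add_zero]
  nlinarith

theorem inv (hx : SmallDilateSum A M x) : SmallDilateSum A M x⁻¹ := by
  rcases eq_or_ne x 0 with rfl | h0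
  · simpa using hx
  · unfold SmallDilateSum at *
    rw [← card_smul_add_smul h0, smul_inv_smul₀ h0, add_comm]
    exact hx

theorem mul (hA : A.Nonempty) (hM : 1 ≤ M) (hN : 1 ≤ N)
    (hx : SmallDilateSum A M x) (hy : SmallDilateSum A N y) :
    SmallDilateSum A (M * N) (x * y) := by
  rcases eq_or_ne x 0 with rfl | h0
  · rw [zero_mul]
    exact zero hA (one_le_mul_of_one_le_of_one_le hM hN)
  · unfold SmallDilateSum at *
    have hpos : (0 : ℝ) < #A := by exact_mod_cast hA.card_pos
    have h := ruzsa_triangle_real A (x • A) ((x * y) • A)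
    rw [mul_smul, card_smul_add_smul h0, card_smul_finset₀ h0] at h
    rw [mul_smul]
    refine le_of_mul_le_mul_right ?_ hpos
    calc _ ≤ _ := h
      _ ≤ (M * #A) * (N * #A) := by gcongr
      _ = _ := by ring

theorem neg (hA : A.Nonempty) (hK : 1 ≤ K) (hM : 1 ≤ M) (hAA : SmallDilateSum A K 1)
    (hx : SmallDilateSum A M x) : SmallDilateSum A (M * K) (-x) := by
  rcases eq_or_ne x 0 with rfl | h0
  · rw [neg_zero]
    exact zero hA (one_le_mul_of_one_le_of_one_le hM hK)
  · unfold SmallDilateSum at *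
    rw [one_smul] at hAA
    have hpos : (0 : ℝ) < #A := by exact_mod_cast hA.card_pos
    have h : (#(A - x • A) : ℝ) * #(x • A) ≤ #(A + x • A) * #(x • A + x • A) := by
      exact_mod_cast ruzsa_triangle_inequality_sub_add_add A (x • A) (x • A)
    rw [card_smul_add_smul h0, card_smul_finset₀ h0] at h
    have e : (-x) • A = -(x • A) := by
      ext z; simp [mem_smul_finset]
    rw [e, ← sub_eq_add_neg]
    refine le_of_mul_le_mul_right ?_ hpos
    calc _ ≤ _ := h
      _ ≤ (M * #A) * (K * #A) := by gcongr
      _ = _ := by ring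

theorem add (hA : A.Nonempty) (hM : 0 ≤ M) (hAA : SmallDilateSum A K 1)
    (hx : SmallDilateSum A M x) (hy : SmallDilateSum A N y) :
    SmallDilateSum A (M * N * K ^ 3) (x + y) := by
  unfold SmallDilateSum at *
  rw [one_smul] at hAA
  have hpos : (0 : ℝ) < #A := by exact_mod_cast hA.card_pos
  have h₁ := ruzsa_triangle_real (A + x • A) A (y • A)
  have h₂ := ruzsa_triangle_real (x • A) A (A + A)
  have h₃ : (#(A + (A + A)) : ℝ) ≤ K ^ 3 * #A := by
    have h := pluennecke_ruzsa_inequality_nsmul_add hA A 3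
    have h' : (#(3 • A) : ℝ) ≤ ((#(A + A) : ℝ) / #A) ^ 3 * #A := by
      have := (NNRat.cast_le (K := ℝ)).2 h
      push_cast at this
      exact this
    have e : 3 • A = A + (A + A) := by rw [succ_nsmul', two_nsmul]
    rw [e] at h'
    refine h'.trans ?_
    gcongr
    rwa [div_le_iff₀ hpos]
  have h₄ : (#(x • A + (A + A)) : ℝ) ≤ M * (K ^ 3 * #A) := by
    refine le_of_mul_le_mul_right ?_ hpos
    calc _ ≤ _ := h₂
      _ ≤ (M * #A) * (K ^ 3 * #A) := by
        rw [add_comm (x • A) A]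
        gcongr
      _ = _ := by ring
  have h₄' : 0 ≤ M * (K ^ 3 * #A) := (Nat.cast_nonneg _).trans h₄
  have h₅ : (#(A + (x + y) • A) : ℝ) ≤ #(A + x • A + y • A) := by
    have : A + (x + y) • A ⊆ A + x • A + y • A := by
      rintro z hz
      obtain ⟨a, ha, w, hw, rfl⟩ := mem_add.1 hz
      obtain ⟨b, hb, rfl⟩ := mem_smul_finset.1 hw
      rw [add_smul, ← add_assoc]
      exact add_mem_add (add_mem_add ha (smul_mem_smul_finset hb)) (smul_mem_smul_finset hb)
    exact_mod_cast card_le_card this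
  refine h₅.trans (le_of_mul_le_mul_right ?_ hpos)
  calc _ ≤ _ := h₁
    _ ≤ (M * (K ^ 3 * #A)) * (N * #A) := by
      rw [add_comm A (x • A), add_assoc]
      gcongr
    _ = _ := by ring

/-- If `M ≤ #A / 2`, there are at most `2 * M * #A` dilates `x • A` with
`#(A + x • A) ≤ M * #A`. -/
theorem card_le (hA : A.Nonempty) (hM : 0 ≤ M) (hMA : 2 * M ≤ #A)
    (S : Finset F) (hS : ∀ x ∈ S, SmallDilateSum A M x) : (#S : ℝ) ≤ 2 * M * #A := by
  have hpos : (0 : ℝ) < #A := by exact_mod_cast hA.card_pos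
  let P := A ×ˢ A
  let f : F → F × F → F := fun x p => p.1 + x * p.2
  have hlow : ∀ x ∈ S, (#A : ℝ) ^ 3 ≤ M * #{z ∈ P ×ˢ P | f x z.1 = f x z.2} := by
    intro x hx
    have h := card_sq_le_card_image_mul_card_coincidences P (f x)
    have e : P.image (f x) = A + x • A := by
      ext z
      simp [P, f, mem_add, mem_smul_finset, and_assoc]
    rw [e, card_product] at h
    have h' : ((#A : ℝ) * #A) ^ 2 ≤ #(A + x • A) * #{z ∈ P ×ˢ P | f x z.1 = f x z.2} := by
      exact_mod_cast h
    refine le_of_mul_le_mul_right ?_ hpos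
    calc (#A : ℝ) ^ 3 * #A = ((#A : ℝ) * #A) ^ 2 := by ring
      _ ≤ _ := h'
      _ ≤ (M * #A) * #{z ∈ P ×ˢ P | f x z.1 = f x z.2} := by
        gcongr
        exact hS x hx
      _ = _ := by ring
  have hup : ∑ x ∈ S, #{z ∈ P ×ˢ P | f x z.1 = f x z.2} ≤ #A ^ 2 * #S + #A ^ 4 := by
    have swap : ∑ x ∈ S, #{z ∈ P ×ˢ P | f x z.1 = f x z.2}
        = ∑ z ∈ P ×ˢ P, #{x ∈ S | f x z.1 = f x z.2} := by
      simp only [card_filter]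
      exact sum_comm
    rw [swap]
    calc _ ≤ ∑ z ∈ P ×ˢ P, ((if z.1 = z.2 then #S else 0) + 1) := by
          refine sum_le_sum fun z _ => ?_
          split_ifs with hz
          · exact (card_filter_le _ _).trans (Nat.le_succ _)
          · rw [zero_add]
            refine card_le_one.2 fun x hx y hy => ?_
            simp only [mem_filter, f] at hx hy
            have h2 : z.1.2 - z.2.2 ≠ 0 := by
              intro h2
              rw [sub_eq_zero] at h2
              refine hz (Prod.ext ?_ h2)
              have := hx.2
              rw [h2] at this
              exact add_right_cancel this
            refine mul_right_cancel₀ h2 ?_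
            linear_combination hx.2 - hy.2
      _ = #A ^ 2 * #S + #A ^ 4 := by
          rw [sum_add_distrib, sum_product]
          have h : ∀ p ∈ P, (∑ p' ∈ P, if p = p' then #S else 0) = #S := fun p hp => by
            rw [sum_ite_eq, if_pos hp]
          rw [sum_congr rfl h]
          simp only [sum_const, card_product, smul_eq_mul, P]
          ring
  have hup' : (∑ x ∈ S, (#{z ∈ P ×ˢ P | f x z.1 = f x z.2} : ℝ)) ≤ #A ^ 2 * #S + #A ^ 4 := by
    exact_mod_cast hup
  have hsum : (#S : ℝ) * #A ^ 3 ≤ M * (#A ^ 2 * #S + #A ^ 4) := by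
    calc (#S : ℝ) * #A ^ 3 = ∑ x ∈ S, (#A : ℝ) ^ 3 := by simp
      _ ≤ ∑ x ∈ S, M * (#{z ∈ P ×ˢ P | f x z.1 = f x z.2} : ℝ) := sum_le_sum hlow
      _ ≤ _ := by
        rw [← mul_sum]
        gcongr
  have hsum' : (#S : ℝ) * #A ≤ M * (#S + #A ^ 2) := by
    refine le_of_mul_le_mul_right ?_ (pow_pos hpos 2)
    linarith
  have hS0 : (0 : ℝ) ≤ #S := by positivity
  refine le_of_mul_le_mul_right ?_ hpos
  nlinarith

end SmallDilateSum

/-- The multiplicative energy of a set of nonzero elements is at most the total size of the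
pairwise intersections of its dilates by its own elements. -/
theorem card_mul_coincidences_le_sum_card_inter {A : Finset F} (h0 : (0 : F) ∉ A) :
    #{z ∈ (A ×ˢ A) ×ˢ (A ×ˢ A) | z.1.1 * z.1.2 = z.2.1 * z.2.2}
        ≤ ∑ b ∈ A, ∑ a ∈ A, #(a • A ∩ b • A) := by
  rw [← sum_product', card_eq_sum_card_fiberwise (f := fun z => (z.2.1, z.1.1)) (t := A ×ˢ A)]
  · refine sum_le_sum fun p hp => ?_
    obtain ⟨hb, ha⟩ := mem_product.1 hp
    have hb0 : p.1 ≠ 0 := fun h => h0 (h ▸ hb)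
    have ha0 : p.2 ≠ 0 := fun h => h0 (h ▸ ha)
    refine card_le_card_of_injOn (fun z => z.1.1 * z.1.2) ?_ ?_
    · rintro ⟨⟨a, c⟩, ⟨b, d⟩⟩ hz
      simp only [coe_filter, mem_filter, mem_product, Set.mem_ofPred_eq, Prod.ext_iff] at hz
      obtain ⟨⟨⟨⟨-, hc⟩, ⟨-, hd⟩⟩, e⟩, rfl, rfl⟩ := hz
      simp only [coe_inter, Set.mem_inter_iff, mem_coe, mem_smul_finset, smul_eq_mul]
      exact ⟨⟨c, hc, rfl⟩, ⟨d, hd, e.symm⟩⟩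
    · rintro ⟨⟨a, c⟩, ⟨b, d⟩⟩ hz ⟨⟨a', c'⟩, ⟨b', d'⟩⟩ hz' h
      simp only [coe_filter, mem_filter, mem_product, Set.mem_ofPred_eq, Prod.ext_iff] at hz hz' h
      obtain ⟨⟨-, e⟩, hzb, hza⟩ := hz
      obtain ⟨⟨-, e'⟩, hzb', hza'⟩ := hz'
      subst hzb hza
      subst hzb' hza'
      have hc := mul_left_cancel₀ ha0 h
      have hd := mul_left_cancel₀ hb0 (e.symm.trans (h.trans e'))
      simp [hc, hd]
  · intro z hz
    simp only [coe_filter, mem_product, Set.mem_ofPred_eq] at hz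
    simp [hz.1.1.1, hz.1.2.1]

/-- A set of nonzero elements with small sum set and product set has many dilates whose sum with
the set is small. -/
theorem exists_many_smallDilateSum {A : Finset F} {K : ℝ} (hA : A.Nonempty) (h0 : (0 : F) ∉ A)
    (hadd : (#(A + A) : ℝ) ≤ K * #A) (hmul : (#(A * A) : ℝ) ≤ K * #A) :
    ∃ B : Finset F, (#A : ℝ) ≤ 2 * K * #B ∧ ∀ x ∈ B, SmallDilateSum A (2 * K ^ 3) x := by
  have hpos : (0 : ℝ) < #A := by exact_mod_cast hA.card_pos
  have hcard : (0 : ℝ) < #(A + A) := by exact_mod_cast (hA.add hA).card_pos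
  have hK : 0 < K := pos_of_mul_pos_left (hcard.trans_le hadd) hpos.le
  have hE : (#A : ℝ) ^ 3 ≤ K * ∑ b ∈ A, ∑ a ∈ A, (#(a • A ∩ b • A) : ℝ) := by
    have h := card_sq_le_card_image_mul_card_coincidences (A ×ˢ A) fun p => p.1 * p.2
    rw [card_product] at h
    have h' := h.trans (Nat.mul_le_mul_left _ (card_mul_coincidences_le_sum_card_inter h0))
    have e : (A ×ˢ A).image (fun p => p.1 * p.2) = A * A := rfl
    rw [e] at h'
    have h'' : ((#A : ℝ) * #A) ^ 2 ≤ #(A * A) * ∑ b ∈ A, ∑ a ∈ A, (#(a • A ∩ b • A) : ℝ) := by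
      exact_mod_cast h'
    refine le_of_mul_le_mul_right ?_ hpos
    calc (#A : ℝ) ^ 3 * #A = ((#A : ℝ) * #A) ^ 2 := by ring
      _ ≤ _ := h''
      _ ≤ (K * #A) * ∑ b ∈ A, ∑ a ∈ A, (#(a • A ∩ b • A) : ℝ) :=
        mul_le_mul_of_nonneg_right hmul
          (sum_nonneg fun _ _ => sum_nonneg fun _ _ => Nat.cast_nonneg _)
      _ = _ := by ring
  obtain ⟨b, hb, hbr⟩ : ∃ b ∈ A, (#A : ℝ) ^ 2 ≤ K * ∑ a ∈ A, (#(a • A ∩ b • A) : ℝ) := by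
    refine exists_le_of_sum_le hA ?_
    rw [← mul_sum, sum_const, nsmul_eq_mul]
    refine le_trans (le_of_eq ?_) hE
    ring
  have hb0 : b ≠ 0 := fun h => h0 (h ▸ hb)
  let A₁ := {a ∈ A | (#A : ℝ) ≤ 2 * K * #(a • A ∩ b • A)}
  refine ⟨b⁻¹ • A₁, ?_, ?_⟩
  · rw [card_smul_finset₀ (inv_ne_zero hb0)]
    have hsplit : K * ∑ a ∈ A, (#(a • A ∩ b • A) : ℝ) ≤ K * (#A₁ * #A) + #A * #A / 2 := by
      have : ∀ a ∈ A, K * (#(a • A ∩ b • A) : ℝ)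
          ≤ (if (#A : ℝ) ≤ 2 * K * #(a • A ∩ b • A) then K * (#A : ℝ) else 0) + #A / 2 := by
        intro a _
        have hr : (#(a • A ∩ b • A) : ℝ) ≤ #A := by
          have : #(a • A ∩ b • A) ≤ #A := (card_le_card inter_subset_right).trans card_smul_finset_le
          exact_mod_cast this
        split_ifs with h
        · have := mul_le_mul_of_nonneg_left hr hK.le
          linarith
        · push Not at h
          linarith
      rw [mul_sum]
      refine (sum_le_sum this).trans (le_of_eq ?_)
      rw [sum_add_distrib, ← sum_filter]
      simp only [sum_const, nsmul_eq_mul, A₁]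
      ring
    refine le_of_mul_le_mul_right ?_ hpos
    linarith
  · intro x hx
    obtain ⟨a, ha, rfl⟩ := mem_smul_finset.1 hx
    obtain ⟨haA, har⟩ := mem_filter.1 ha
    have ha0 : a ≠ 0 := fun h => h0 (h ▸ haA)
    have hrpos : (0 : ℝ) < #(a • A ∩ b • A) :=
      pos_of_mul_pos_right (hpos.trans_le har) (by positivity)
    unfold SmallDilateSum
    rw [← card_smul_add_smul hb0, smul_eq_mul, smul_smul, mul_inv_cancel_left₀ hb0]
    have h := ruzsa_triangle_real (b • A) (a • A ∩ b • A) (a • A)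
    have h₁ : (#(b • A + a • A ∩ b • A) : ℝ) ≤ #(A + A) := by
      rw [← card_smul_add_smul hb0 A A]
      exact_mod_cast card_le_card (add_subset_add_left inter_subset_right)
    have h₂ : (#(a • A ∩ b • A + a • A) : ℝ) ≤ #(A + A) := by
      rw [← card_smul_add_smul ha0 A A]
      exact_mod_cast card_le_card (add_subset_add_right inter_subset_left)
    refine le_of_mul_le_mul_right ?_ hrpos
    calc _ ≤ _ := h
      _ ≤ (K * #A) * (K * #A) := by
        gcongr
        · exact h₁.trans hadd
        · exact h₂.trans hadd
      _ = K ^ 2 * #A * #A := by ring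
      _ ≤ K ^ 2 * #A * (2 * K * #(a • A ∩ b • A)) := by gcongr
      _ = _ := by ring

/-- If `y` is not a quotient of differences of `B`, the map `(s, t) ↦ s + y * t` is injective on
`B × B`. -/
theorem card_add_smul_of_not_mem_quotients {B : Finset F} {y : F}
    (hy : y ∉ (B - B) / (B - B)) : #(B + y • B) = #B * #B := by
  rw [← card_product]
  have e : (B ×ˢ B).image (fun p => p.1 + y * p.2) = B + y • B := by
    ext z
    simp [mem_add, mem_smul_finset, and_assoc]
  rw [← e]
  refine card_image_of_injOn ?_
  rintro ⟨s, t⟩ hp ⟨s', t'⟩ hp' h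
  simp only [coe_product, Set.mem_prod, mem_coe] at hp hp' h
  rcases eq_or_ne t t' with rfl | hne
  · rw [add_right_cancel h]
  · refine (hy ?_).elim
    have e : y = (s - s') / (t' - t) := by
      rw [eq_div_iff (sub_ne_zero.2 hne.symm)]
      linear_combination -h
    rw [e]
    exact div_mem_div (sub_mem_sub hp.1 hp'.1) (sub_mem_sub hp'.2 hp.2)

end Dilates

open Finset in
theorem ZMod.exists_mem_add_one_not_mem {q : ℕ} [NeZero q] {R : Finset (ZMod q)} (h0 : 0 ∈ R)
    (hR : R ≠ univ) : ∃ r ∈ R, r + 1 ∉ R := by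
  by_contra! h
  have hn : ∀ n : ℕ, (n : ZMod q) ∈ R := by
    intro n
    induction n with
    | zero => simpa using h0
    | succ n ih => simpa using h _ ih
  refine hR (eq_univ_of_forall fun x => ?_)
  simpa using hn x.val

open Finset in
/-- Either a set of nonzero residues is close to all of `ZMod q`, or it is small, or one of its sum
set and its product set is large. -/
theorem ZMod.le_or_le_of_card_add_card_mul_le {q : ℕ} [Fact q.Prime] {A : Finset (ZMod q)} {K : ℝ}
    (hA : A.Nonempty) (h0 : (0 : ZMod q) ∉ A)
    (hadd : (#(A + A) : ℝ) ≤ K * #A) (hmul : (#(A * A) : ℝ) ≤ K * #A) :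
    (#A : ℝ) ≤ 2 * (2 * K) ^ 35 ∨ (q : ℝ) ≤ 2 * (2 * K) ^ 20 * #A := by
  by_contra! hcon
  obtain ⟨hsmall, hbig⟩ := hcon
  have hpos : (0 : ℝ) < #A := by exact_mod_cast hA.card_pos
  have hK : 1 ≤ K := by
    have : (#A : ℝ) ≤ #(A + A) := by
      exact_mod_cast card_le_card_add_right hA
    refine le_of_mul_le_mul_right ?_ hpos
    linarith
  obtain ⟨B, hBcard, hB⟩ := exists_many_smallDilateSum hA h0 hadd hmul
  obtain ⟨L, hL⟩ : ∃ L, L = 2 * K := ⟨_, rfl⟩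
  rw [← hL] at hsmall hbig hBcard
  have hL1 : 1 ≤ L := by linarith
  have hpow : ∀ n : ℕ, 1 ≤ L ^ n := fun n => one_le_pow₀ hL1
  have hone : SmallDilateSum A L 1 := by
    unfold SmallDilateSum
    rw [one_smul]
    refine hadd.trans ?_
    gcongr
    linarith
  have hB3 : ∀ x ∈ B, SmallDilateSum A (L ^ 3) x := fun x hx => (hB x hx).mono (by
    have : 0 ≤ K ^ 3 := by positivity
    rw [hL, mul_pow]
    linarith)
  have hsub : ∀ x ∈ B - B, SmallDilateSum A (L ^ 10) x := by
    intro x hx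
    obtain ⟨s, hs, t, ht, rfl⟩ := mem_sub.1 hx
    rw [sub_eq_add_neg]
    refine (SmallDilateSum.add hA (by positivity) hone (hB3 s hs)
      (SmallDilateSum.neg hA hL1 (hpow 3) hone (hB3 t ht))).mono (le_of_eq ?_)
    ring
  have hdiv : ∀ x ∈ (B - B) / (B - B), SmallDilateSum A (L ^ 20) x := by
    intro x hx
    obtain ⟨s, hs, t, ht, rfl⟩ := mem_div.1 hx
    rw [div_eq_mul_inv]
    refine (SmallDilateSum.mul hA (hpow 10) (hpow 10) (hsub s hs) (hsub t ht).inv).mono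
      (le_of_eq ?_)
    ring
  have hBne : B.Nonempty := by
    rw [nonempty_iff_ne_empty]
    rintro rfl
    simp at hBcard
    exact hA.ne_empty hBcard
  have hne : (B - B) / (B - B) ≠ univ := by
    intro h
    have h' := SmallDilateSum.card_le hA (by positivity : 0 ≤ L ^ 20)
      (by
        have : L ^ 20 ≤ L ^ 35 := pow_le_pow_right₀ hL1 (by norm_num)
        linarith) _ hdiv
    rw [h, card_univ, ZMod.card] at h'
    linarith
  have hzero : 0 ∈ (B - B) / (B - B) := by
    obtain ⟨b, hb⟩ := hBne
    exact mem_div.2 ⟨b - b, sub_mem_sub hb hb, b - b, sub_mem_sub hb hb, by simp⟩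
  obtain ⟨y, hy, hy1⟩ := ZMod.exists_mem_add_one_not_mem hzero hne
  have hy24 : SmallDilateSum A (L ^ 24) (y + 1) :=
    (SmallDilateSum.add hA (by positivity) hone (hdiv y hy) hone).mono
      (le_of_eq (by ring))
  have hsum : ∀ x ∈ B + (y + 1) • B, SmallDilateSum A (L ^ 33) x := by
    intro x hx
    obtain ⟨s, hs, t, ht, rfl⟩ := mem_add.1 hx
    obtain ⟨u, hu, rfl⟩ := mem_smul_finset.1 ht
    exact (SmallDilateSum.add hA (by positivity) hone (hB3 s hs)
      (SmallDilateSum.mul hA (hpow 24) (hpow 3) hy24 (hB3 u hu))).mono (le_of_eq (by ring))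
  have hfin := SmallDilateSum.card_le hA (by positivity : 0 ≤ L ^ 33)
    (by
      have : L ^ 33 ≤ L ^ 35 := pow_le_pow_right₀ hL1 (by norm_num)
      linarith) _ hsum
  rw [card_add_smul_of_not_mem_quotients hy1] at hfin
  push_cast at hfin
  have : (#A : ℝ) * #A ≤ 2 * L ^ 35 * #A := by
    calc (#A : ℝ) * #A ≤ (L * #B) * (L * #B) := by gcongr
      _ = L ^ 2 * (#B * #B) := by ring
      _ ≤ L ^ 2 * (2 * L ^ 33 * #A) := by gcongr
      _ = _ := by ring
  have := le_of_mul_le_mul_right this hpos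
  linarith

theorem sum_product_estimate :
    ∀ δ : ℝ, 0 < δ → ∃ ε : ℝ, 0 < ε ∧ ∃ c : ℝ, 0 < c ∧
      ∀ q : ℕ, q.Prime → ∀ A : Finset (ZMod q),
        (q : ℝ) ^ δ < (A.card : ℝ) → (A.card : ℝ) < (q : ℝ) ^ (1 - δ) →
        c * (A.card : ℝ) ^ (1 + ε) ≤ (max ((A + A).card) ((A * A).card) : ℕ) := by
  intro δ hδ
  have hε : 0 < min (1 / 35) (δ / 20) := lt_min (by norm_num) (by positivity)
  refine ⟨min (1 / 35) (δ / 20), hε, 1 / 16, by norm_num, ?_⟩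
  obtain ⟨ε, hεdef⟩ : ∃ ε, ε = min (1 / 35) (δ / 20) := ⟨_, rfl⟩
  have hε35 : ε * 35 ≤ 1 := by
    have := min_le_left (1 / 35) (δ / 20)
    linarith
  have hε20 : ε * 20 ≤ δ := by
    have := min_le_right (1 / 35) (δ / 20)
    linarith
  rw [← hεdef] at hε ⊢
  intro q hq A hlow hup
  have : Fact q.Prime := ⟨hq⟩
  by_contra! hcon
  have hq1 : (1 : ℝ) ≤ q := by exact_mod_cast hq.one_le
  have hA1 : (1 : ℝ) < A.card := (Real.one_le_rpow hq1 hδ.le).trans_lt hlow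
  have hA0 : (0 : ℝ) < A.card := by linarith
  have hA2 : (2 : ℝ) ≤ A.card := by
    have : 1 < A.card := by exact_mod_cast hA1
    exact_mod_cast this
  have hAq : (A.card : ℝ) ≤ q := by
    have := A.card_le_univ
    rw [ZMod.card] at this
    exact_mod_cast this
  obtain ⟨A', hA'⟩ : ∃ A', A' = A.erase 0 := ⟨_, rfl⟩
  have hsub : A' ⊆ A := hA' ▸ A.erase_subset 0
  have hcard : (A.card : ℝ) ≤ 2 * A'.card := by
    have : A.card ≤ A'.card + 1 := by
      have := A.pred_card_le_card_erase (a := 0)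
      rw [hA']
      omega
    have : (A.card : ℝ) ≤ A'.card + 1 := by exact_mod_cast this
    linarith
  have hcard' : (A'.card : ℝ) ≤ A.card := by exact_mod_cast Finset.card_le_card hsub
  have hne : A'.Nonempty := by
    rw [← Finset.card_pos]
    have : (0 : ℝ) < A'.card := by linarith
    exact_mod_cast this
  obtain ⟨T, hT⟩ : ∃ T, T = (A.card : ℝ) ^ ε := ⟨_, rfl⟩
  have hT0 : 0 < T := hT ▸ Real.rpow_pos_of_pos hA0 ε
  rw [Real.rpow_add hA0, Real.rpow_one, ← hT] at hcon
  have hmax : ∀ n : ℕ, n ≤ max (A + A).card (A * A).card → (n : ℝ) ≤ T / 8 * A'.card := by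
    intro n hn
    have : (n : ℝ) ≤ (max (A + A).card (A * A).card : ℕ) := by exact_mod_cast hn
    nlinarith
  have hT35 : T ^ 35 ≤ A.card := by
    rw [hT, ← Real.rpow_natCast, ← Real.rpow_mul hA0.le]
    calc _ ≤ (A.card : ℝ) ^ (1 : ℝ) := Real.rpow_le_rpow_of_exponent_le hA1.le (by
          push_cast; exact hε35)
      _ = _ := Real.rpow_one _
  have hT20 : T ^ 20 * A.card < q := by
    have h₁ : T ^ 20 ≤ (q : ℝ) ^ δ := by
      rw [hT, ← Real.rpow_natCast, ← Real.rpow_mul hA0.le]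
      calc _ ≤ (q : ℝ) ^ (ε * (20 : ℕ)) := by gcongr
        _ ≤ _ := Real.rpow_le_rpow_of_exponent_le hq1 (by push_cast; exact hε20)
    calc T ^ 20 * A.card < T ^ 20 * (q : ℝ) ^ (1 - δ) := by gcongr
      _ ≤ (q : ℝ) ^ δ * (q : ℝ) ^ (1 - δ) := by gcongr
      _ = q := by
        rw [← Real.rpow_add (by linarith)]
        simp
  rcases ZMod.le_or_le_of_card_add_card_mul_le hne (hA' ▸ Finset.notMem_erase 0 A)
      (hmax _ ((Finset.card_le_card (Finset.add_subset_add hsub hsub)).trans (le_max_left _ _)))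
      (hmax _ ((Finset.card_le_card (Finset.mul_subset_mul hsub hsub)).trans (le_max_right _ _)))
    with h | h
  · have e : 2 * (2 * (T / 8)) ^ 35 = 2 / 4 ^ 35 * T ^ 35 := by ring
    rw [e] at h
    have : (2 / 4 ^ 35 : ℝ) * T ^ 35 ≤ 2 / 4 ^ 35 * A.card := by gcongr
    norm_num at this h
    linarith
  · have e : 2 * (2 * (T / 8)) ^ 20 * (A'.card : ℝ) = 2 / 4 ^ 20 * (T ^ 20 * A'.card) := by ring
    rw [e] at h
    have : T ^ 20 * A'.card ≤ T ^ 20 * A.card := by gcongr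
    norm_num at h
    linarith
end

section
/- Let F be a finite field and let A, B be finite non-empty subsets of F. Then there exists an invertible element ξ ∈ F \ {0} such that |A + ξ·B| ≥ min((1/2)·|A|·|B|, (1/10)·|F|), where A + ξ·B := {a + ξb : a ∈ A, b ∈ B}. -/
open Pointwise

/-- The additive energy of `A` and `ξ • B` is at most the number of solutions of
`a + ξ b = a' + ξ b'`. -/
lemma addEnergy_smul_le {F : Type*} [Field F] [DecidableEq F] (A B : Finset F) {ξ : F}
    (hξ : ξ ≠ 0) :
    Finset.addEnergy A (ξ • B) ≤
      (((A ×ˢ A) ×ˢ B ×ˢ B).filter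
        (fun x => x.1.1 + ξ * x.2.1 = x.1.2 + ξ * x.2.2)).card := by
  unfold Finset.addEnergy
  apply Finset.card_le_card_of_injOn (fun x => (x.1, ξ⁻¹ * x.2.1, ξ⁻¹ * x.2.2))
  · rintro ⟨⟨a, a'⟩, c, c'⟩ h
    simp only [Finset.coe_filter, Finset.mem_product, Set.mem_ofPred_eq,
      Finset.mem_smul_finset, smul_eq_mul] at h ⊢
    obtain ⟨⟨ha, ⟨b, hb, rfl⟩, b', hb', rfl⟩, h⟩ := h
    simp only [inv_mul_cancel_left₀ hξ]
    exact ⟨⟨ha, hb, hb'⟩, h⟩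
  · rintro ⟨⟨a, a'⟩, c, c'⟩ - ⟨⟨d, d'⟩, e, e'⟩ - h
    simpa [hξ] using h

/-- The number of nonzero dilations `ξ` solving `a + ξ b = a' + ξ b'`. -/
lemma card_dilations_le {F : Type*} [Field F] [Fintype F] [DecidableEq F] (a a' b b' : F) :
    (((Finset.univ.erase (0 : F)).filter (fun ξ => a + ξ * b = a' + ξ * b')).card : ℝ) ≤
      (if a = a' ∧ b = b' then (Fintype.card F : ℝ) - 1 else 0) +
        (if a ≠ a' ∧ b ≠ b' then 1 else 0) := by
  by_cases hb : b = b'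
  · subst hb
    by_cases ha : a = a'
    · subst ha
      simp [Finset.card_erase_of_mem, Nat.cast_sub Fintype.card_pos]
    · simp [ha]
  · by_cases ha : a = a'
    · subst ha
      simp [hb]
    · simp only [ha, hb, ne_eq, not_false_eq_true, and_self, if_true, if_false, zero_add]
      norm_cast
      refine Finset.card_le_one.2 fun x hx y hy => ?_
      simp only [Finset.mem_filter] at hx hy
      exact mul_right_cancel₀ (sub_ne_zero.2 hb) (by linear_combination hx.2 - hy.2)

lemma sum_addEnergy_smul_le {F : Type*} [Field F] [Fintype F] [DecidableEq F]
    (A B : Finset F) :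
    ∑ ξ ∈ Finset.univ.erase (0 : F), (Finset.addEnergy A (ξ • B) : ℝ) ≤
      A.card * B.card * ((Fintype.card F : ℝ) - 1) +
        A.card * (A.card - 1) * (B.card * (B.card - 1)) := by
  have hdiag (S : Finset F) :
      ∑ x ∈ S ×ˢ S, (if x.1 = x.2 then (1 : ℝ) else 0) = S.card := by
    rw [Finset.sum_product]
    simp
  have hoff (S : Finset F) :
      ∑ x ∈ S ×ˢ S, (if x.1 ≠ x.2 then (1 : ℝ) else 0) = S.card * (S.card - 1) := by
    have h (x : F × F) :
        (if x.1 ≠ x.2 then (1 : ℝ) else 0) = 1 - if x.1 = x.2 then 1 else 0 := by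
      split_ifs <;> simp_all
    simp only [h, Finset.sum_sub_distrib, hdiag]
    simp
    ring
  calc ∑ ξ ∈ Finset.univ.erase (0 : F), (Finset.addEnergy A (ξ • B) : ℝ)
      ≤ ∑ ξ ∈ Finset.univ.erase (0 : F), ∑ x ∈ (A ×ˢ A) ×ˢ B ×ˢ B,
          if x.1.1 + ξ * x.2.1 = x.1.2 + ξ * x.2.2 then (1 : ℝ) else 0 := by
        refine Finset.sum_le_sum fun ξ hξ => ?_
        rw [Finset.sum_boole]
        exact_mod_cast addEnergy_smul_le A B (Finset.ne_of_mem_erase hξ)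
    _ = ∑ x ∈ (A ×ˢ A) ×ˢ B ×ˢ B, (((Finset.univ.erase (0 : F)).filter
          (fun ξ => x.1.1 + ξ * x.2.1 = x.1.2 + ξ * x.2.2)).card : ℝ) := by
        rw [Finset.sum_comm]
        simp only [Finset.sum_boole]
    _ ≤ ∑ x ∈ (A ×ˢ A) ×ˢ B ×ˢ B,
          ((if x.1.1 = x.1.2 then (1 : ℝ) else 0) * (if x.2.1 = x.2.2 then (1 : ℝ) else 0) *
              ((Fintype.card F : ℝ) - 1) +
            (if x.1.1 ≠ x.1.2 then (1 : ℝ) else 0) *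
              (if x.2.1 ≠ x.2.2 then (1 : ℝ) else 0)) := by
        refine Finset.sum_le_sum fun x _ => (card_dilations_le _ _ _ _).trans_eq ?_
        by_cases h₁ : x.1.1 = x.1.2 <;> by_cases h₂ : x.2.1 = x.2.2 <;> simp [h₁, h₂]
    _ = _ := by
        rw [Finset.sum_add_distrib, ← Finset.sum_mul, ← hdiag A, ← hdiag B, Finset.sum_mul_sum,
          ← Finset.sum_product', hdiag, hdiag, ← hoff A, ← hoff B, Finset.sum_mul_sum,
          ← Finset.sum_product']

theorem dilated_sum_lower_bound {F : Type*} [Field F] [Fintype F] [DecidableEq F]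
    (A B : Finset F) (hA : A.Nonempty) (hB : B.Nonempty) :
    ∃ ξ : F, ξ ≠ 0 ∧
      min ((1 / 2 : ℝ) * A.card * B.card) ((1 / 10 : ℝ) * Fintype.card F)
        ≤ ((A + ξ • B).card : ℝ) := by
  have hq : (1 : ℝ) < Fintype.card F := by exact_mod_cast Fintype.one_lt_card
  have hn : (1 : ℝ) ≤ A.card := by exact_mod_cast hA.card_pos
  have hm : (1 : ℝ) ≤ B.card := by exact_mod_cast hB.card_pos
  have hnq : (A.card : ℝ) ≤ Fintype.card F := by exact_mod_cast A.card_le_univ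
  have hmq : (B.card : ℝ) ≤ Fintype.card F := by exact_mod_cast B.card_le_univ
  have hcard : ((Finset.univ.erase (0 : F)).card : ℝ) = (Fintype.card F : ℝ) - 1 := by
    simp [Finset.card_erase_of_mem, Nat.cast_sub Fintype.card_pos]
  have hsum := sum_addEnergy_smul_le A B
  set q := (Fintype.card F : ℝ)
  set n := (A.card : ℝ)
  set m := (B.card : ℝ)
  obtain ⟨ξ, hξ, hE⟩ : ∃ ξ ∈ Finset.univ.erase (0 : F),
      (Finset.addEnergy A (ξ • B) : ℝ) ≤ n * m + n * (n - 1) * (m * (m - 1)) / (q - 1) := by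
    refine Finset.exists_le_of_sum_le ⟨1, by simp⟩ (hsum.trans_eq ?_)
    rw [Finset.sum_const, nsmul_eq_mul, hcard]
    have : q - 1 ≠ 0 := by linarith
    field_simp
  have hξ0 := Finset.ne_of_mem_erase hξ
  refine ⟨ξ, hξ0, ?_⟩
  have hCS : (n * m) ^ 2 ≤ (A + ξ • B).card * (Finset.addEnergy A (ξ • B) : ℝ) := by
    have := Finset.le_card_add_mul_addEnergy A (ξ • B)
    rw [Finset.card_smul_finset₀ hξ0] at this
    rw [mul_pow]
    simp only [n, m]
    exact_mod_cast this
  set s := ((A + ξ • B).card : ℝ)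
  have hs : 0 ≤ s := Nat.cast_nonneg _
  have hnm : 0 < n * m := by positivity
  have hratio : (n - 1) * (m - 1) / (q - 1) ≤ n * m / q := by
    rw [div_le_div_iff₀ (by linarith) (by linarith)]
    nlinarith [mul_nonneg (sub_nonneg.2 hn) (sub_nonneg.2 hmq),
      mul_nonneg (sub_nonneg.2 hm) (sub_nonneg.2 hq.le)]
  have hE' : (Finset.addEnergy A (ξ • B) : ℝ) ≤ n * m * (1 + n * m / q) := by
    refine hE.trans ?_
    calc _ = n * m * (1 + (n - 1) * (m - 1) / (q - 1)) := by ring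
      _ ≤ _ := by gcongr
  have key : n * m ≤ s * (1 + n * m / q) := by
    refine le_of_mul_le_mul_left ?_ hnm
    nlinarith [mul_le_mul_of_nonneg_left hE' hs]
  rcases le_total (n * m) q with h | h
  · refine (min_le_left _ _).trans ?_
    have : n * m / q ≤ 1 := (div_le_one (by linarith)).2 h
    nlinarith [mul_le_mul_of_nonneg_left this hs]
  · refine (min_le_right _ _).trans ?_
    have h₁ : 1 ≤ n * m / q := (one_le_div (by linarith)).2 h
    have h₂ : n * m = q * (n * m / q) := by field_simp
    have h₃ : q * (n * m / q) ≤ (2 * s) * (n * m / q) := by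
      nlinarith [mul_le_mul_of_nonneg_left h₁ hs]
    have := le_of_mul_le_mul_right h₃ (by linarith)
    linarith
end

section
/- There exist absolute constants C ≥ 1 and c > 0 such that: for every field F, every finite non-empty subset A of F, and every real K ≥ 1 with |A+A| ≤ K·|A| and |A·A| ≤ K·|A|, there is a subset A' of A with |A'| ≥ c·K^{-C}·|A| and |A'·A' − A'·A'| ≤ C·K^C·|A'|. -/
open Pointwise

/-- Cauchy–Schwarz lower bound for the number of collisions of a map between finite sets. -/
theorem sq_card_le_card_mul_card_collisions {α β : Type*} [DecidableEq β]
    {s : Finset α} {t : Finset β} {f : α → β} (hf : ∀ x ∈ s, f x ∈ t) :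
    s.card ^ 2 ≤ t.card * ∑ x ∈ s, (s.filter fun y => f x = f y).card := by
  have h : ∑ x ∈ s, (s.filter fun y => f x = f y).card
      = ∑ c ∈ t, (s.filter fun y => f y = c).card ^ 2 := by
    rw [← Finset.sum_fiberwise_of_maps_to hf]
    refine Finset.sum_congr rfl fun c _ => ?_
    rw [sq, ← smul_eq_mul, ← Finset.sum_const]
    refine Finset.sum_congr rfl fun x hx => ?_
    rw [(Finset.mem_filter.1 hx).2]
    simp only [eq_comm]
  rw [h, Finset.card_eq_sum_card_fiberwise hf]
  exact sq_sum_le_card_mul_sum_sq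

section

variable {F : Type*} [Field F] [DecidableEq F]

/-- If `A * A` is small, many dilates of `A` have a large intersection with a common one. -/
theorem exists_subset_card_le_card_dilate_inter {A : Finset F} (hA : A.Nonempty)
    (h0 : (0 : F) ∉ A) {K : ℝ} (hK : 1 ≤ K) (hmul : ((A * A).card : ℝ) ≤ K * A.card) :
    ∃ b ∈ A, ∃ A₁ ⊆ A, (A.card : ℝ) ≤ 2 * K * A₁.card ∧
      ∀ a ∈ A₁, (A.card : ℝ) ≤ 2 * K * (a • A ∩ b • A).card := by
  have hpos : (0 : ℝ) < A.card := by exact_mod_cast hA.card_pos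
  have hcs := sq_card_le_card_mul_card_collisions (s := A ×ˢ A) (t := A * A)
    (f := fun p => p.1 * p.2) fun p hp =>
      Finset.mul_mem_mul (Finset.mem_product.1 hp).1 (Finset.mem_product.1 hp).2
  have hle : ∑ p ∈ A ×ˢ A, ((A ×ˢ A).filter fun q => p.1 * p.2 = q.1 * q.2).card
      ≤ ∑ b ∈ A, ∑ a ∈ A, (a • A ∩ b • A).card := by
    rw [Finset.sum_product]
    refine Finset.sum_le_sum fun b hb => ?_
    have hb0 : b ≠ 0 := fun h => h0 (h ▸ hb)
    rw [← Finset.card_sigma, ← Finset.card_sigma]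
    refine Finset.card_le_card_of_injOn (fun z => ⟨z.2.1, b * z.1⟩) ?_ ?_
    · rintro ⟨v, a, u⟩ h
      simp only [Finset.coe_sigma, Set.mem_sigma_iff, Finset.mem_coe, Finset.mem_filter,
        Finset.mem_product, Finset.mem_inter] at h ⊢
      exact ⟨h.2.1.1, h.2.2 ▸ Finset.smul_mem_smul_finset h.2.1.2,
        Finset.smul_mem_smul_finset h.1⟩
    · rintro ⟨v, a, u⟩ h ⟨v', a', u'⟩ h' e
      simp only [Finset.coe_sigma, Set.mem_sigma_iff, Finset.mem_coe, Finset.mem_filter,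
        Finset.mem_product] at h h'
      simp only [Sigma.mk.injEq, heq_eq_eq] at e
      obtain ⟨rfl, e⟩ := e
      obtain rfl := mul_left_cancel₀ hb0 e
      have ha0 : a ≠ 0 := fun hz => h0 (hz ▸ h.2.1.1)
      obtain rfl := mul_left_cancel₀ ha0 (h.2.2.symm.trans h'.2.2)
      rfl
  have hcs' : (A.card : ℝ) ^ 4
      ≤ K * A.card * ∑ b ∈ A, ∑ a ∈ A, ((a • A ∩ b • A).card : ℝ) := by
    have h := hcs.trans (Nat.mul_le_mul_left _ hle)
    have h' : ((A ×ˢ A).card : ℝ) ^ 2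
        ≤ (A * A).card * ∑ b ∈ A, ∑ a ∈ A, ((a • A ∩ b • A).card : ℝ) := by exact_mod_cast h
    rw [Finset.card_product] at h'
    push_cast at h'
    calc (A.card : ℝ) ^ 4 = (A.card * A.card : ℝ) ^ 2 := by ring
      _ ≤ _ := h'
      _ ≤ _ := by gcongr
  obtain ⟨b, hb, hbA⟩ : ∃ b ∈ A,
      (A.card : ℝ) ^ 2 ≤ K * ∑ a ∈ A, ((a • A ∩ b • A).card : ℝ) := by
    refine Finset.exists_le_of_sum_le hA ?_
    rw [Finset.sum_const, nsmul_eq_mul, ← Finset.mul_sum]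
    refine le_of_mul_le_mul_left ?_ hpos
    linarith
  refine ⟨b, hb, A.filter fun a => (A.card : ℝ) ≤ 2 * K * (a • A ∩ b • A).card,
    Finset.filter_subset _ _, ?_, fun a ha => (Finset.mem_filter.1 ha).2⟩
  set A₁ := A.filter fun a => (A.card : ℝ) ≤ 2 * K * (a • A ∩ b • A).card with hA₁
  have hsum : ∑ a ∈ A, 2 * K * ((a • A ∩ b • A).card : ℝ)
      ≤ ∑ a ∈ A, ((A.card : ℝ) +
        if (A.card : ℝ) ≤ 2 * K * (a • A ∩ b • A).card then 2 * K * A.card else 0) := by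
    refine Finset.sum_le_sum fun a _ => ?_
    split_ifs with h
    · have : ((a • A ∩ b • A).card : ℝ) ≤ A.card := by
        exact_mod_cast (Finset.card_le_card Finset.inter_subset_left).trans Finset.card_image_le
      nlinarith
    · linarith
  rw [Finset.sum_add_distrib, ← Finset.sum_filter, ← hA₁, Finset.sum_const, Finset.sum_const,
    nsmul_eq_mul, nsmul_eq_mul, ← Finset.mul_sum] at hsum
  refine le_of_mul_le_mul_left ?_ hpos
  linarith

/-- If `A + A` is small and `a • A` meets `b • A` in a large set, then `a • A` is covered by few
translates of `b • A - b • A`. -/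
theorem exists_cover_dilate_of_card_le_card_inter {A : Finset F} (hA : A.Nonempty) {K : ℝ}
    (hK : 1 ≤ K) (hadd : ((A + A).card : ℝ) ≤ K * A.card) {a b : F}
    (hab : (A.card : ℝ) ≤ 2 * K * (a • A ∩ b • A).card) :
    ∃ X : Finset F, (X.card : ℝ) ≤ 2 * K ^ 2 ∧
      ∀ u ∈ A, ∃ x ∈ X, ∃ v ∈ A, ∃ w ∈ A, a * u = x + b * v - b * w := by
  have hpos : (0 : ℝ) < A.card := by exact_mod_cast hA.card_pos
  set B := a • A ∩ b • A
  have hB : B.Nonempty := by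
    rw [Finset.nonempty_iff_ne_empty]
    intro h
    rw [h] at hab
    simp at hab
    exact hA.ne_empty hab
  have hcard : ((a • A + B).card : ℝ) ≤ 2 * K ^ 2 * B.card := by
    have h : (a • A + B).card ≤ (A + A).card :=
      calc (a • A + B).card ≤ (a • A + a • A).card :=
            Finset.card_le_card (Finset.add_subset_add_left Finset.inter_subset_left)
        _ = (a • (A + A)).card := by rw [smul_add]
        _ ≤ (A + A).card := Finset.card_image_le
    have h' : ((a • A + B).card : ℝ) ≤ (A + A).card := by exact_mod_cast h
    nlinarith
  obtain ⟨X, -, hX, hcov⟩ := Finset.ruzsa_covering_add hB hcard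
  refine ⟨X, hX, fun u hu => ?_⟩
  obtain ⟨x, hx, y, hy, hxy⟩ := Finset.mem_add.1 (hcov (Finset.smul_mem_smul_finset (a := a) hu))
  obtain ⟨p, hp, q, hq, rfl⟩ := Finset.mem_sub.1 hy
  obtain ⟨v, hv, rfl⟩ := Finset.mem_smul_finset.1 (Finset.mem_inter.1 hp).2
  obtain ⟨w, hw, rfl⟩ := Finset.mem_smul_finset.1 (Finset.mem_inter.1 hq).2
  refine ⟨x, hx, v, hv, w, hw, ?_⟩
  simp only [smul_eq_mul] at hxy
  rw [← hxy]
  ring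

/-- Coverings of two dilates compose to a covering of the dilate by the product. -/
theorem exists_cover_mul_dilate {A X Y : Finset F} {M : ℝ} (hX : (X.card : ℝ) ≤ M)
    (hY : (Y.card : ℝ) ≤ M) {a a' b : F}
    (ha : ∀ u ∈ A, ∃ x ∈ X, ∃ v ∈ A, ∃ w ∈ A, a * u = x + b * v - b * w)
    (ha' : ∀ u ∈ A, ∃ x ∈ Y, ∃ v ∈ A, ∃ w ∈ A, a' * u = x + b * v - b * w) :
    ∃ Z : Finset F, (Z.card : ℝ) ≤ M ^ 3 ∧
      ∀ u ∈ A, ∃ z ∈ Z, ∃ v ∈ A, ∃ v' ∈ A, ∃ w ∈ A, ∃ w' ∈ A,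
        a * a' * u = z + b ^ 2 * (v + v' - (w + w')) := by
  refine ⟨a • Y + b • (X - X), ?_, fun u hu => ?_⟩
  · have h : (a • Y + b • (X - X)).card ≤ Y.card * (X.card * X.card) :=
      Finset.card_add_le.trans (Nat.mul_le_mul Finset.card_image_le
        (Finset.card_image_le.trans Finset.card_sub_le))
    have hM : 0 ≤ M := (Nat.cast_nonneg _).trans hX
    calc ((a • Y + b • (X - X)).card : ℝ) ≤ Y.card * (X.card * X.card) := by exact_mod_cast h
      _ ≤ M * (M * M) := by gcongr
      _ = M ^ 3 := by ring
  · obtain ⟨y, hy, v, hv, w, hw, e⟩ := ha' u hu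
    obtain ⟨x₁, hx₁, v₁, hv₁, w₁, hw₁, e₁⟩ := ha v hv
    obtain ⟨x₂, hx₂, v₂, hv₂, w₂, hw₂, e₂⟩ := ha w hw
    refine ⟨a • y + b • (x₁ - x₂), Finset.add_mem_add (Finset.smul_mem_smul_finset hy)
      (Finset.smul_mem_smul_finset (Finset.sub_mem_sub hx₁ hx₂)),
      v₁, hv₁, w₂, hw₂, w₁, hw₁, v₂, hv₂, ?_⟩
    simp only [smul_eq_mul]
    linear_combination a * e + b * e₁ - b * e₂

/-- If two dilates of `A` are covered by few translates of `d • (2A - 2A)`, then the dilate by the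
difference of the factors has a small sum with `d • A`. -/
theorem card_sub_dilate_add_dilate_le {A Z Z' : Finset F} (hA : A.Nonempty) {K M : ℝ}
    (hadd : ((A + A).card : ℝ) ≤ K * A.card) (hZ : (Z.card : ℝ) ≤ M) (hZ' : (Z'.card : ℝ) ≤ M)
    {p p' d : F}
    (hp : ∀ u ∈ A, ∃ z ∈ Z, ∃ v ∈ A, ∃ v' ∈ A, ∃ w ∈ A, ∃ w' ∈ A,
      p * u = z + d * (v + v' - (w + w')))
    (hp' : ∀ u ∈ A, ∃ z ∈ Z', ∃ v ∈ A, ∃ v' ∈ A, ∃ w ∈ A, ∃ w' ∈ A,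
      p' * u = z + d * (v + v' - (w + w'))) :
    (((p - p') • A + d • A).card : ℝ) ≤ M ^ 2 * K ^ 9 * A.card := by
  have hpos : (0 : ℝ) < A.card := by exact_mod_cast hA.card_pos
  have hsub : (p - p') • A + d • A ⊆ (Z - Z') + d • (5 • A - 4 • A) := by
    intro y hy
    obtain ⟨_, hs, _, hr, rfl⟩ := Finset.mem_add.1 hy
    obtain ⟨u, hu, rfl⟩ := Finset.mem_smul_finset.1 hs
    obtain ⟨t, ht, rfl⟩ := Finset.mem_smul_finset.1 hr
    obtain ⟨z₁, hz₁, v₁, hv₁, v₂, hv₂, w₁, hw₁, w₂, hw₂, e₁⟩ := hp u hu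
    obtain ⟨z₂, hz₂, v₃, hv₃, v₄, hv₄, w₃, hw₃, w₄, hw₄, e₂⟩ := hp' u hu
    have h5 : v₁ + v₂ + w₃ + w₄ + t ∈ 5 • A := by
      simp only [succ_nsmul, zero_nsmul, zero_add]
      exact Finset.add_mem_add (Finset.add_mem_add (Finset.add_mem_add
        (Finset.add_mem_add hv₁ hv₂) hw₃) hw₄) ht
    have h4 : w₁ + w₂ + v₃ + v₄ ∈ 4 • A := by
      simp only [succ_nsmul, zero_nsmul, zero_add]
      exact Finset.add_mem_add (Finset.add_mem_add (Finset.add_mem_add hw₁ hw₂) hv₃) hv₄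
    refine Finset.mem_add.2 ⟨z₁ - z₂, Finset.sub_mem_sub hz₁ hz₂, _,
      Finset.smul_mem_smul_finset (Finset.sub_mem_sub h5 h4), ?_⟩
    simp only [smul_eq_mul]
    linear_combination e₂ - e₁
  have hpr : ((5 • A - 4 • A).card : ℝ) ≤ K ^ 9 * A.card := by
    have h := Finset.pluennecke_ruzsa_inequality_nsmul_sub_nsmul_add hA A 5 4
    have h' : ((5 • A - 4 • A).card : ℝ) ≤ ((A + A).card / A.card : ℝ) ^ 9 * A.card := by
      simpa using (NNRat.cast_le (K := ℝ)).2 h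
    refine h'.trans ?_
    gcongr
    exact (div_le_iff₀ hpos).2 hadd
  have h : ((p - p') • A + d • A).card ≤ Z.card * Z'.card * (5 • A - 4 • A).card :=
    (Finset.card_le_card hsub).trans (Finset.card_add_le.trans
      (Nat.mul_le_mul Finset.card_sub_le Finset.card_image_le))
  have hM : 0 ≤ M := (Nat.cast_nonneg _).trans hZ
  calc (((p - p') • A + d • A).card : ℝ) ≤ Z.card * Z'.card * (5 • A - 4 • A).card := by
        exact_mod_cast h
    _ ≤ M * M * (K ^ 9 * A.card) := by gcongr
    _ = _ := by ring

/-- There are few `x` for which `x • A + d • A` is small. -/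
theorem card_mul_card_le_of_card_dilate_add_dilate_le {A S : Finset F} (hA : A.Nonempty) {L : ℝ}
    (hL : 0 ≤ L) {d : F} (hd : d ≠ 0) (hS : ∀ x ∈ S, ((x • A + d • A).card : ℝ) ≤ L * A.card) :
    (S.card : ℝ) * A.card ≤ L * A.card ^ 2 + L * S.card := by
  have hpos : (0 : ℝ) < A.card := by exact_mod_cast hA.card_pos
  have hcs : ∀ x ∈ S, (A.card : ℝ) ^ 3 ≤ L * ∑ p ∈ A ×ˢ A,
      (((A ×ˢ A).filter fun q => x * p.1 + d * p.2 = x * q.1 + d * q.2).card : ℝ) := by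
    intro x hx
    have h := sq_card_le_card_mul_card_collisions (s := A ×ˢ A) (t := x • A + d • A)
      (f := fun p => x * p.1 + d * p.2) fun p hp =>
        Finset.add_mem_add (Finset.smul_mem_smul_finset (Finset.mem_product.1 hp).1)
          (Finset.smul_mem_smul_finset (Finset.mem_product.1 hp).2)
    rw [Finset.card_product] at h
    have h' : (A.card * A.card : ℝ) ^ 2 ≤ (x • A + d • A).card * ∑ p ∈ A ×ˢ A,
      (((A ×ˢ A).filter fun q => x * p.1 + d * p.2 = x * q.1 + d * q.2).card : ℝ) := by
      exact_mod_cast h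
    have h'' := h'.trans (mul_le_mul_of_nonneg_right (hS x hx)
      (Finset.sum_nonneg fun _ _ => Nat.cast_nonneg _))
    refine le_of_mul_le_mul_left ?_ hpos
    linarith
  have hcount : ∑ x ∈ S, ∑ p ∈ A ×ˢ A,
      ((A ×ˢ A).filter fun q => x * p.1 + d * p.2 = x * q.1 + d * q.2).card
      ≤ A.card ^ 4 + S.card * A.card ^ 2 := by
    calc _ = ∑ p ∈ A ×ˢ A, ∑ q ∈ A ×ˢ A,
          (S.filter fun x => x * p.1 + d * p.2 = x * q.1 + d * q.2).card := by
          simp only [Finset.card_filter]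
          rw [Finset.sum_comm]
          exact Finset.sum_congr rfl fun p _ => Finset.sum_comm
      _ ≤ ∑ p ∈ A ×ˢ A, ∑ q ∈ A ×ˢ A, (1 + if p = q then S.card else 0) := by
          refine Finset.sum_le_sum fun p _ => Finset.sum_le_sum fun q _ => ?_
          split_ifs with h
          · exact (Finset.card_filter_le _ _).trans (Nat.le_add_left _ _)
          · refine Finset.card_le_one.2 fun x hx y hy => ?_
            have ex := (Finset.mem_filter.1 hx).2
            have ey := (Finset.mem_filter.1 hy).2
            have hne : p.1 - q.1 ≠ 0 := by
              intro h1
              refine h (Prod.ext (sub_eq_zero.1 h1) (mul_left_cancel₀ hd ?_))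
              linear_combination ex - x * h1
            refine mul_right_cancel₀ hne ?_
            linear_combination ex - ey
      _ = A.card ^ 4 + S.card * A.card ^ 2 := by
          simp only [Finset.sum_add_distrib, Finset.sum_ite_eq, Finset.sum_const, smul_eq_mul,
            Finset.card_product, mul_one, Finset.sum_ite_mem, Finset.inter_self]
          ring
  have hsum := Finset.sum_le_sum hcs
  rw [Finset.sum_const, nsmul_eq_mul, ← Finset.mul_sum] at hsum
  have hcount' : ∑ x ∈ S, ∑ p ∈ A ×ˢ A,
      (((A ×ˢ A).filter fun q => x * p.1 + d * p.2 = x * q.1 + d * q.2).card : ℝ)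
      ≤ (A.card : ℝ) ^ 4 + S.card * A.card ^ 2 := by exact_mod_cast hcount
  have h := hsum.trans (mul_le_mul_of_nonneg_left hcount' hL)
  refine le_of_mul_le_mul_left ?_ (pow_pos hpos 2)
  linarith

/-- The Katz–Tao lemma for sets that do not contain zero. -/
theorem exists_subset_card_mul_sub_mul_le {A : Finset F} (hA : A.Nonempty) (h0 : (0 : F) ∉ A)
    {K : ℝ} (hK : 1 ≤ K) (hadd : ((A + A).card : ℝ) ≤ K * A.card)
    (hmul : ((A * A).card : ℝ) ≤ K * A.card) :
    ∃ A' ⊆ A, (A.card : ℝ) ≤ 256 * K ^ 22 * A'.card ∧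
      ((A' * A' - A' * A').card : ℝ) ≤ 256 * K ^ 22 * A'.card := by
  have hpow : (1 : ℝ) ≤ K ^ 21 := one_le_pow₀ hK
  have hpow' : K ^ 22 = K ^ 21 * K := pow_succ _ _
  rcases le_or_gt (A.card : ℝ) (128 * K ^ 21) with hsmall | hlarge
  · obtain ⟨a, ha⟩ := hA
    refine ⟨{a}, Finset.singleton_subset_iff.2 ha, ?_, ?_⟩
    · simp only [Finset.card_singleton, Nat.cast_one]
      nlinarith
    · simp only [Finset.singleton_mul_singleton, Finset.singleton_sub_singleton,
        Finset.card_singleton, Nat.cast_one]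
      nlinarith
  obtain ⟨b, hb, A₁, hA₁, hcard, hinter⟩ :=
    exists_subset_card_le_card_dilate_inter hA h0 hK hmul
  have hb0 : b ≠ 0 := fun h => h0 (h ▸ hb)
  have hprod : ∀ a ∈ A₁, ∀ a' ∈ A₁, ∃ Z : Finset F, (Z.card : ℝ) ≤ (2 * K ^ 2) ^ 3 ∧
      ∀ u ∈ A, ∃ z ∈ Z, ∃ v ∈ A, ∃ v' ∈ A, ∃ w ∈ A, ∃ w' ∈ A,
        a * a' * u = z + b ^ 2 * (v + v' - (w + w')) := by
    intro a ha a' ha'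
    obtain ⟨X, hX, hXc⟩ := exists_cover_dilate_of_card_le_card_inter hA hK hadd (hinter a ha)
    obtain ⟨Y, hY, hYc⟩ := exists_cover_dilate_of_card_le_card_inter hA hK hadd (hinter a' ha')
    exact exists_cover_mul_dilate hX hY hXc hYc
  have hS : ∀ x ∈ A₁ * A₁ - A₁ * A₁,
      ((x • A + (b ^ 2) • A).card : ℝ) ≤ 64 * K ^ 21 * A.card := by
    intro x hx
    obtain ⟨p, hp, p', hp', rfl⟩ := Finset.mem_sub.1 hx
    obtain ⟨a₁, ha₁, a₂, ha₂, rfl⟩ := Finset.mem_mul.1 hp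
    obtain ⟨a₃, ha₃, a₄, ha₄, rfl⟩ := Finset.mem_mul.1 hp'
    obtain ⟨Z, hZ, hZc⟩ := hprod a₁ ha₁ a₂ ha₂
    obtain ⟨Z', hZ', hZc'⟩ := hprod a₃ ha₃ a₄ ha₄
    exact (card_sub_dilate_add_dilate_le hA hadd hZ hZ' hZc hZc').trans_eq (by ring)
  have hcount := card_mul_card_le_of_card_dilate_add_dilate_le hA (by positivity) (pow_ne_zero 2 hb0) hS
  refine ⟨A₁, hA₁, ?_, ?_⟩
  · refine hcard.trans (mul_le_mul_of_nonneg_right ?_ (Nat.cast_nonneg _))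
    nlinarith
  · have hpos : (0 : ℝ) < A.card := by exact_mod_cast hA.card_pos
    have h : ((A₁ * A₁ - A₁ * A₁).card : ℝ) ≤ 128 * K ^ 21 * A.card := by
      refine le_of_mul_le_mul_right ?_ hpos
      nlinarith [mul_le_mul_of_nonneg_left hlarge.le
        (Nat.cast_nonneg (α := ℝ) (A₁ * A₁ - A₁ * A₁).card)]
    calc ((A₁ * A₁ - A₁ * A₁).card : ℝ) ≤ 128 * K ^ 21 * A.card := h
      _ ≤ 128 * K ^ 21 * (2 * K * A₁.card) := by gcongr
      _ = _ := by ring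

/-- The Katz–Tao lemma with explicit integer exponents. -/
theorem exists_subset_card_mul_sub_mul_le_of_nonempty {A : Finset F} (hA : A.Nonempty)
    {K : ℝ} (hK : 1 ≤ K) (hadd : ((A + A).card : ℝ) ≤ K * A.card)
    (hmul : ((A * A).card : ℝ) ≤ K * A.card) :
    ∃ A' ⊆ A, (A.card : ℝ) ≤ 2 ^ 31 * K ^ 22 * A'.card ∧
      ((A' * A' - A' * A').card : ℝ) ≤ 2 ^ 31 * K ^ 22 * A'.card := by
  have hpow : (1 : ℝ) ≤ K ^ 22 := one_le_pow₀ hK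
  have hsub : A.erase 0 ⊆ A := Finset.erase_subset _ _
  obtain hemp | hne := (A.erase 0).eq_empty_or_nonempty
  · obtain rfl : A = {0} := by
      rcases Finset.erase_eq_empty_iff _ _ |>.1 hemp with h | h
      · exact absurd h hA.ne_empty
      · exact h
    refine ⟨{0}, subset_rfl, ?_, ?_⟩ <;> simp <;> linarith
  have hcard : (A.card : ℝ) ≤ 2 * (A.erase 0).card := by
    have h1 := hne.card_pos
    have h2 := Finset.pred_card_le_card_erase (s := A) (a := 0)
    exact_mod_cast (by omega : A.card ≤ 2 * (A.erase 0).card)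
  have hadd' : ((A.erase 0 + A.erase 0).card : ℝ) ≤ 2 * K * (A.erase 0).card := by
    have h : ((A.erase 0 + A.erase 0).card : ℝ) ≤ (A + A).card := by
      exact_mod_cast Finset.card_le_card (Finset.add_subset_add hsub hsub)
    nlinarith
  have hmul' : ((A.erase 0 * A.erase 0).card : ℝ) ≤ 2 * K * (A.erase 0).card := by
    have h : ((A.erase 0 * A.erase 0).card : ℝ) ≤ (A * A).card := by
      exact_mod_cast Finset.card_le_card (Finset.mul_subset_mul hsub hsub)
    nlinarith
  obtain ⟨A', hA', h1, h2⟩ := exists_subset_card_mul_sub_mul_le hne (Finset.notMem_erase 0 A)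
    (by linarith : 1 ≤ 2 * K) hadd' hmul'
  rw [mul_pow] at h1 h2
  have hnn : 0 ≤ K ^ 22 * A'.card := by positivity
  exact ⟨A', hA'.trans hsub, by linarith, by linarith⟩

end

theorem katz_tao_refinement :
    ∃ C : ℝ, 1 ≤ C ∧ ∃ c : ℝ, 0 < c ∧
      ∀ (F : Type*) [Field F] [DecidableEq F] (A : Finset F), A.Nonempty →
        ∀ K : ℝ, 1 ≤ K →
          ((A + A).card : ℝ) ≤ K * A.card →
          ((A * A).card : ℝ) ≤ K * A.card →
          ∃ A' : Finset F, A' ⊆ A ∧ c * K ^ (-C) * A.card ≤ (A'.card : ℝ) ∧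
            ((A' * A' - A' * A').card : ℝ) ≤ C * K ^ C * A'.card := by
  refine ⟨2 ^ 31, by norm_num, (2 ^ 31)⁻¹, by norm_num, ?_⟩
  intro F _ _ A hA K hK hadd hmul
  have hK0 : 0 < K := by linarith
  obtain ⟨A', hA', h1, h2⟩ := exists_subset_card_mul_sub_mul_le_of_nonempty hA hK hadd hmul
  have hpow : K ^ 22 ≤ K ^ (2 ^ 31 : ℝ) := by
    rw [← Real.rpow_natCast]
    exact Real.rpow_le_rpow_of_exponent_le hK (by norm_num)
  have hmono : 2 ^ 31 * K ^ 22 * (A'.card : ℝ) ≤ 2 ^ 31 * K ^ (2 ^ 31 : ℝ) * A'.card := by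
    gcongr
  refine ⟨A', hA', ?_, h2.trans hmono⟩
  rw [Real.rpow_neg hK0.le, ← mul_inv, inv_mul_le_iff₀ (by positivity)]
  exact h1.trans hmono
end

section
/- Let P be a polynomial in n variables with integer coefficients. Then there exists a constant C = C(P) ≥ 1 such that: for every field F, every finite subset A of F with 1 ∈ A, and every real K ≥ 1 with |A·A − A·A| ≤ K·|A|, one has |P(A, …, A)| ≤ C·K^C·|A|, where P(A,…,A) := {P(a₁,…,aₙ) : a₁,…,aₙ ∈ A} (the integer coefficients acting on F via the canonical ring map ℤ → F). -/
open Pointwise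

section Tame

variable {F : Type*} [Field F] [DecidableEq F] {A X Y D : Finset F} {K : ℝ} {c d : ℕ}

/-- The set `A` contains `1`, and `A * A - A * A` exceeds `A` in size by a factor of at most `K`. -/
structure SmallGrowth (A : Finset F) (K : ℝ) : Prop where
  one_mem : 1 ∈ A
  one_le : 1 ≤ K
  card_le : ((A * A - A * A).card : ℝ) ≤ K * A.card

/-- `X + A` exceeds `A` in size by a factor of at most `K ^ c`. -/
def Tame (A X : Finset F) (K : ℝ) (c : ℕ) : Prop :=
  ((X + A).card : ℝ) ≤ K ^ c * A.card

/-- `X` is tame, and so is every dilate of `A` by an element of `X`. -/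
def StronglyTame (A X : Finset F) (K : ℝ) (c : ℕ) : Prop :=
  Tame A X K c ∧ ∀ y ∈ X, Tame A ({y} * A) K c

theorem Tame.mono_exponent (hX : Tame A X K c) (hK : 1 ≤ K) (h : c ≤ d) : Tame A X K d :=
  hX.trans (mul_le_mul_of_nonneg_right (pow_le_pow_right₀ hK h) (Nat.cast_nonneg _))

theorem Tame.subset (hX : Tame A X K c) (h : Y ⊆ X) : Tame A Y K c :=
  le_trans (Nat.cast_le.2 (Finset.card_le_card (Finset.add_subset_add_right h))) hX

theorem StronglyTame.mono_exponent (hX : StronglyTame A X K c) (hK : 1 ≤ K) (h : c ≤ d) :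
    StronglyTame A X K d :=
  ⟨hX.1.mono_exponent hK h, fun y hy => (hX.2 y hy).mono_exponent hK h⟩

theorem StronglyTame.subset (hX : StronglyTame A X K c) (h : Y ⊆ X) : StronglyTame A Y K c :=
  ⟨hX.1.subset h, fun y hy => hX.2 y (h hy)⟩

theorem Tame.of_subset_biUnion {f : F → Finset F} (hK : 1 ≤ K)
    (hY : (Y.card : ℝ) ≤ K ^ d) (hf : ∀ y ∈ Y, Tame A (f y) K c) (h : X ⊆ Y.biUnion f) :
    Tame A X K (c + d) := by
  have hsub : X + A ⊆ Y.biUnion fun y => f y + A := by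
    intro z hz
    obtain ⟨x, hx, a, ha, rfl⟩ := Finset.mem_add.1 hz
    obtain ⟨y, hy, hxy⟩ := Finset.mem_biUnion.1 (h hx)
    exact Finset.mem_biUnion.2 ⟨y, hy, Finset.add_mem_add hxy ha⟩
  have hc : 0 ≤ K ^ c * A.card := by positivity
  calc ((X + A).card : ℝ) ≤ ∑ y ∈ Y, ((f y + A).card : ℝ) := by
        exact_mod_cast (Finset.card_le_card hsub).trans Finset.card_biUnion_le
    _ ≤ Y.card * (K ^ c * A.card) := by
        simpa using Finset.sum_le_card_nsmul Y _ _ hf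
    _ ≤ K ^ d * (K ^ c * A.card) := mul_le_mul_of_nonneg_right hY hc
    _ = K ^ (c + d) * A.card := by ring

theorem Tame.of_subset_add (hK : 1 ≤ K) (hY : (Y.card : ℝ) ≤ K ^ d) (hD : Tame A D K c)
    (h : X ⊆ Y + D) : Tame A X K (c + d) := by
  refine Tame.of_subset_biUnion (f := fun y => {y} + D) hK hY (fun y _ => ?_) ?_
  · have : ({y} + D + A).card = (D + A).card := by
      rw [add_assoc, Finset.card_singleton_add]
    simpa only [Tame, this] using hD
  · intro x hx
    obtain ⟨y, hy, e, he, rfl⟩ := Finset.mem_add.1 (h hx)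
    exact Finset.mem_biUnion.2 ⟨y, hy, Finset.add_mem_add (Finset.mem_singleton_self y) he⟩

theorem Tame.exists_cover (hA : A.Nonempty) (hX : Tame A X K c) :
    ∃ Y ⊆ X, (Y.card : ℝ) ≤ K ^ c ∧ X ⊆ Y + (A - A) :=
  Finset.ruzsa_covering_add hA hX

theorem StronglyTame.zero : StronglyTame A {0} K 0 := by
  have h0 : Tame A {0} K 0 := by simp [Tame]
  refine ⟨h0, fun y hy => h0.subset ?_⟩
  obtain rfl := Finset.mem_singleton.1 hy
  intro z hz
  obtain ⟨_, hx, b, -, rfl⟩ := Finset.mem_mul.1 hz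
  simp [Finset.mem_singleton.1 hx]

namespace SmallGrowth

theorem subset_mul_self (h : SmallGrowth A K) : A ⊆ A * A :=
  fun a ha => by simpa using Finset.mul_mem_mul ha h.one_mem

theorem tame_of_add_subset (h : SmallGrowth A K)
    (hD : D + A ⊆ (A * A + A * A + A * A) - (A * A + A * A)) : Tame A D K 5 := by
  have hA : A.Nonempty := ⟨1, h.one_mem⟩
  have hpos : (0 : ℝ) < A.card := by exact_mod_cast hA.card_pos
  have key := Finset.pluennecke_ruzsa_inequality_nsmul_sub_nsmul_sub hA (A * A) 3 2
  rw [succ_nsmul, two_nsmul] at key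
  have key' : (((A * A + A * A + A * A) - (A * A + A * A)).card : ℝ)
      ≤ ((A - A * A).card / A.card : ℝ) ^ 5 * A.card := by
    simpa using NNRat.cast_le (K := ℝ) |>.2 key
  refine le_trans (Nat.cast_le.2 (Finset.card_le_card hD)) (key'.trans ?_)
  gcongr
  rw [div_le_iff₀ hpos]
  refine le_trans ?_ h.card_le
  exact_mod_cast Finset.card_le_card (Finset.sub_subset_sub_right h.subset_mul_self)

theorem tame_mul_self_sub (h : SmallGrowth A K) : Tame A (A * A - A * A) K 5 := by
  refine h.tame_of_add_subset fun z hz => ?_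
  obtain ⟨_, hx, a, ha, rfl⟩ := Finset.mem_add.1 hz
  obtain ⟨b, hb, c, hc, rfl⟩ := Finset.mem_sub.1 hx
  have h1 : (1 : F) ∈ A * A := h.subset_mul_self h.one_mem
  refine Finset.mem_sub.2 ⟨b + a + 1, ?_, c + 1, Finset.add_mem_add hc h1, by ring⟩
  exact Finset.add_mem_add (Finset.add_mem_add hb (h.subset_mul_self ha)) h1

theorem tame_sub_add_sub (h : SmallGrowth A K) : Tame A ((A - A) + (A - A)) K 5 := by
  have hs := h.subset_mul_self
  refine h.tame_of_add_subset ?_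
  rw [sub_add_sub_comm, sub_add_eq_add_sub]
  exact Finset.sub_subset_sub (Finset.add_subset_add (Finset.add_subset_add hs hs) hs)
    (Finset.add_subset_add hs hs)

theorem tame_mul_self (h : SmallGrowth A K) : Tame A (A * A) K 5 := by
  have h1 : (1 : F) ∈ A * A := h.subset_mul_self h.one_mem
  refine (h.tame_mul_self_sub.of_subset_add (Y := {1}) (d := 0) h.one_le (by simp)
    fun z hz => ?_)
  exact Finset.mem_add.2 ⟨1, Finset.mem_singleton_self 1, z - 1, Finset.sub_mem_sub hz h1, by ring⟩

theorem tame_sub_self (h : SmallGrowth A K) : Tame A (A - A) K 5 :=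
  h.tame_mul_self_sub.subset (Finset.sub_subset_sub h.subset_mul_self h.subset_mul_self)

theorem tame_singleton_mul (h : SmallGrowth A K) {a : F} (ha : a ∈ A) : Tame A ({a} * A) K 5 :=
  h.tame_mul_self.subset (Finset.mul_subset_mul_right (Finset.singleton_subset_iff.2 ha))

theorem tame_neg (h : SmallGrowth A K) (hX : Tame A X K c) : Tame A (-X) K (5 + c) := by
  obtain ⟨Y, -, hY, hXY⟩ := hX.exists_cover ⟨1, h.one_mem⟩
  refine Tame.of_subset_add (Y := -Y) h.one_le (by simpa using hY) h.tame_sub_self ?_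
  simpa [add_comm] using Finset.neg_subset_neg hXY

theorem tame_add (h : SmallGrowth A K) (hX : Tame A X K c) (hY : Tame A Y K d) :
    Tame A (X + Y) K (5 + (c + d)) := by
  obtain ⟨X', -, hX', hXX'⟩ := hX.exists_cover ⟨1, h.one_mem⟩
  obtain ⟨Y', -, hY', hYY'⟩ := hY.exists_cover ⟨1, h.one_mem⟩
  have hK := h.one_le
  refine Tame.of_subset_add (Y := X' + Y') hK ?_ h.tame_sub_add_sub ?_
  · calc ((X' + Y').card : ℝ) ≤ X'.card * Y'.card := by exact_mod_cast Finset.card_add_le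
      _ ≤ K ^ c * K ^ d := by gcongr
      _ = K ^ (c + d) := (pow_add K c d).symm
  · rw [add_add_add_comm]
    exact Finset.add_subset_add hXX' hYY'

theorem tame_mul (h : SmallGrowth A K) (hX : StronglyTame A X K c) :
    Tame A (X * A) K (2 * c + 10) := by
  obtain ⟨Y, hYX, hY, hXY⟩ := hX.1.exists_cover ⟨1, h.one_mem⟩
  have key : Tame A (X * A) K (5 + (c + 5) + c) := by
    have hf : ∀ y ∈ Y, Tame A ({y} * A + (A * A - A * A)) K (5 + (c + 5)) :=
      fun y hy => h.tame_add (hX.2 y (hYX hy)) h.tame_mul_self_sub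
    refine Tame.of_subset_biUnion h.one_le hY hf fun z hz => ?_
    obtain ⟨x, hx, a, ha, rfl⟩ := Finset.mem_mul.1 hz
    obtain ⟨y, hy, _, he, rfl⟩ := Finset.mem_add.1 (hXY hx)
    obtain ⟨b, hb, b', hb', rfl⟩ := Finset.mem_sub.1 he
    refine Finset.mem_biUnion.2 ⟨y, hy, ?_⟩
    have hya : y * a ∈ {y} * A := Finset.mul_mem_mul (Finset.mem_singleton_self y) ha
    have hba : b * a - b' * a ∈ A * A - A * A :=
      Finset.sub_mem_sub (Finset.mul_mem_mul hb ha) (Finset.mul_mem_mul hb' ha)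
    exact Finset.mem_add.2 ⟨_, hya, _, hba, by ring⟩
  exact key.mono_exponent h.one_le (by omega)

theorem tame_singleton_mul_mul (h : SmallGrowth A K) {a y : F} (ha : a ∈ A)
    (hy : Tame A ({y} * A) K c) : Tame A ({y * a} * A) K (c + 20) := by
  obtain ⟨Z, -, hZ, hyZ⟩ := hy.exists_cover ⟨1, h.one_mem⟩
  have hDa := h.tame_singleton_mul ha
  have hZa : (({a} * Z).card : ℝ) ≤ K ^ c :=
    le_trans (by exact_mod_cast (Finset.card_mul_le (s := {a}) (t := Z)).trans (by simp)) hZ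
  have key : Tame A ({y * a} * A) K (5 + (5 + (5 + 5)) + c) := by
    refine Tame.of_subset_add h.one_le hZa (h.tame_add hDa (h.tame_neg hDa)) fun z hz => ?_
    obtain ⟨_, hx, b, hb, rfl⟩ := Finset.mem_mul.1 hz
    obtain rfl := Finset.mem_singleton.1 hx
    have hyb := hyZ (Finset.mul_mem_mul (Finset.mem_singleton_self y) hb)
    obtain ⟨w, hw, _, he, hwe⟩ := Finset.mem_add.1 hyb
    obtain ⟨b₁, hb₁, b₂, hb₂, rfl⟩ := Finset.mem_sub.1 he
    have ha' := Finset.mem_singleton_self a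
    refine Finset.mem_add.2 ⟨a * w, Finset.mul_mem_mul ha' hw, a * b₁ + -(a * b₂),
      Finset.add_mem_add (Finset.mul_mem_mul ha' hb₁)
        (Finset.neg_mem_neg (Finset.mul_mem_mul ha' hb₂)), ?_⟩
    linear_combination a * hwe
  exact key.mono_exponent h.one_le (by omega)

theorem stronglyTame_self (h : SmallGrowth A K) : StronglyTame A A K 5 :=
  ⟨h.tame_mul_self.subset h.subset_mul_self, fun _ ha => h.tame_singleton_mul ha⟩

theorem stronglyTame_neg (h : SmallGrowth A K) (hX : StronglyTame A X K c) :
    StronglyTame A (-X) K (5 + c) := by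
  refine ⟨h.tame_neg hX.1, fun y hy => (h.tame_neg (hX.2 (-y) (Finset.mem_neg'.1 hy))).subset ?_⟩
  rw [← Finset.neg_singleton, neg_mul, neg_neg]

theorem stronglyTame_add (h : SmallGrowth A K) (hX : StronglyTame A X K c)
    (hY : StronglyTame A Y K d) : StronglyTame A (X + Y) K (5 + (c + d)) := by
  refine ⟨h.tame_add hX.1 hY.1, fun z hz => ?_⟩
  obtain ⟨x, hx, y, hy, rfl⟩ := Finset.mem_add.1 hz
  refine (h.tame_add (hX.2 x hx) (hY.2 y hy)).subset ?_
  rw [← Finset.singleton_add_singleton]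
  exact Finset.add_mul_subset _ _ _

theorem stronglyTame_mul (h : SmallGrowth A K) (hX : StronglyTame A X K c) :
    StronglyTame A (X * A) K (2 * c + 20) := by
  refine ⟨(h.tame_mul hX).mono_exponent h.one_le (by omega), fun z hz => ?_⟩
  obtain ⟨y, hy, a, ha, rfl⟩ := Finset.mem_mul.1 hz
  exact (h.tame_singleton_mul_mul ha (hX.2 y hy)).mono_exponent h.one_le (by omega)

end SmallGrowth

end Tame

/-- The set of values of `P` at points with all coordinates in `A`. -/
noncomputable def polynomialValues {n : ℕ} {F : Type*} [Field F] [DecidableEq F]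
    (P : MvPolynomial (Fin n) ℤ) (A : Finset F) : Finset F :=
  (Fintype.piFinset fun _ : Fin n => A).image fun a => MvPolynomial.aeval a P

section PolynomialValues

variable {n : ℕ} {F : Type*} [Field F] [DecidableEq F]

theorem mem_polynomialValues {P : MvPolynomial (Fin n) ℤ} {A : Finset F} {x : F} :
    x ∈ polynomialValues P A ↔ ∃ a : Fin n → F, (∀ i, a i ∈ A) ∧ MvPolynomial.aeval a P = x := by
  simp [polynomialValues]

theorem polynomialValues_add_subset (P Q : MvPolynomial (Fin n) ℤ) (A : Finset F) :
    polynomialValues (P + Q) A ⊆ polynomialValues P A + polynomialValues Q A := by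
  intro x hx
  obtain ⟨a, ha, rfl⟩ := mem_polynomialValues.1 hx
  rw [map_add]
  exact Finset.add_mem_add (mem_polynomialValues.2 ⟨a, ha, rfl⟩)
    (mem_polynomialValues.2 ⟨a, ha, rfl⟩)

theorem polynomialValues_mul_X_subset (P : MvPolynomial (Fin n) ℤ) (i : Fin n) (A : Finset F) :
    polynomialValues (P * MvPolynomial.X i) A ⊆ polynomialValues P A * A := by
  intro x hx
  obtain ⟨a, ha, rfl⟩ := mem_polynomialValues.1 hx
  rw [map_mul, MvPolynomial.aeval_X]
  exact Finset.mul_mem_mul (mem_polynomialValues.2 ⟨a, ha, rfl⟩) (ha i)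

theorem polynomialValues_C_subset (m : ℤ) (A : Finset F) :
    polynomialValues (MvPolynomial.C m : MvPolynomial (Fin n) ℤ) A ⊆ {(m : F)} := by
  intro x hx
  obtain ⟨a, -, rfl⟩ := mem_polynomialValues.1 hx
  simp

end PolynomialValues

theorem exists_stronglyTame_intCast (m : ℤ) :
    ∃ c : ℕ, ∀ (F : Type*) [Field F] [DecidableEq F] (A : Finset F) (K : ℝ),
      SmallGrowth A K → StronglyTame A {(m : F)} K c := by
  induction m using Int.induction_on with
  | zero => exact ⟨0, fun F _ _ A K h => by simpa using StronglyTame.zero⟩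
  | succ i ih =>
    obtain ⟨c, hc⟩ := ih
    refine ⟨_, fun F _ _ A K h =>
      (h.stronglyTame_add (hc F A K h) h.stronglyTame_self).subset ?_⟩
    simpa using Finset.add_mem_add (Finset.mem_singleton_self (i : F)) h.one_mem
  | pred i ih =>
    obtain ⟨c, hc⟩ := ih
    refine ⟨_, fun F _ _ A K h =>
      (h.stronglyTame_add (hc F A K h) (h.stronglyTame_neg h.stronglyTame_self)).subset ?_⟩
    simpa [sub_eq_add_neg] using
      Finset.add_mem_add (Finset.mem_singleton_self (-i : F)) (Finset.neg_mem_neg h.one_mem)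

theorem exists_stronglyTame_polynomialValues {n : ℕ} (P : MvPolynomial (Fin n) ℤ) :
    ∃ c : ℕ, ∀ (F : Type*) [Field F] [DecidableEq F] (A : Finset F) (K : ℝ),
      SmallGrowth A K → StronglyTame A (polynomialValues P A) K c := by
  induction P using MvPolynomial.induction_on with
  | C m =>
    obtain ⟨c, hc⟩ := exists_stronglyTame_intCast m
    exact ⟨c, fun F _ _ A K h => (hc F A K h).subset (polynomialValues_C_subset m A)⟩
  | add P Q ihP ihQ =>
    obtain ⟨c, hc⟩ := ihP
    obtain ⟨d, hd⟩ := ihQ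
    exact ⟨_, fun F _ _ A K h => (h.stronglyTame_add (hc F A K h) (hd F A K h)).subset
      (polynomialValues_add_subset P Q A)⟩
  | mul_X P i ih =>
    obtain ⟨c, hc⟩ := ih
    exact ⟨_, fun F _ _ A K h => (h.stronglyTame_mul (hc F A K h)).subset
      (polynomialValues_mul_X_subset P i A)⟩

theorem polynomial_expression_bound (n : ℕ) (P : MvPolynomial (Fin n) ℤ) :
    ∃ C : ℝ, 1 ≤ C ∧
      ∀ (F : Type*) [Field F] [DecidableEq F] (A : Finset F), (1 : F) ∈ A →
        ∀ K : ℝ, 1 ≤ K →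
          ((A * A - A * A).card : ℝ) ≤ K * A.card →
          ((((Fintype.piFinset fun _ : Fin n => A).image
              fun a => MvPolynomial.aeval a P).card : ℝ)) ≤ C * K ^ C * A.card := by
  obtain ⟨c, hc⟩ := exists_stronglyTame_polynomialValues P
  refine ⟨(c + 1 : ℕ), by simp, fun F _ _ A h1 K hK hcard => ?_⟩
  have htame : Tame A (polynomialValues P A) K c := (hc F A K ⟨h1, hK, hcard⟩).1
  have hle : ((polynomialValues P A).card : ℝ) ≤ (polynomialValues P A + A).card := by
    exact_mod_cast Finset.card_le_card_add_right ⟨1, h1⟩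
  refine (hle.trans htame).trans ?_
  rw [Real.rpow_natCast]
  gcongr
  calc K ^ c ≤ K ^ (c + 1) := pow_le_pow_right₀ hK (Nat.le_succ c)
    _ ≤ (c + 1 : ℕ) * K ^ (c + 1) :=
      le_mul_of_one_le_left (by positivity) (by simp)
end

section
/- For every integer k ≥ 0 there exists a constant C_k ≥ 1 such that: for every field F, every finite subset A of F with 1 ∈ A, and every real K ≥ 1 with |A·A − A·A| ≤ K·|A|, there exists a set X ⊆ F with |X| ≤ C_k·K^{C_k} such that A^k ⊆ X + (A − A), where A^k := {a₁·a₂⋯a_k : a₁,…,a_k ∈ A} is the k-fold product set (A^0 := {1}) and A − A := {a − b : a,b ∈ A}. -/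
open Pointwise

/-- A form of Ruzsa's covering lemma: if `A` has small difference set and `S` is covered by
translates of `3A - 3A`, then `S` is covered by few translates of `A - A`, with centres in `S`. -/
lemma Finset.exists_subset_add_sub_of_subset_add_three {G : Type*} [AddCommGroup G] [DecidableEq G]
    {A S Z : Finset G} {K : ℝ} (hA : A.Nonempty) (hK : ((A - A).card : ℝ) ≤ K * A.card)
    (hS : S ⊆ Z + ((A - A) + (A - A) + (A - A))) :
    ∃ X ⊆ S, (X.card : ℝ) ≤ Z.card * K ^ 7 ∧ S ⊆ X + (A - A) := by
  have hA0 : (0 : ℝ) < A.card := by exact_mod_cast hA.card_pos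
  have hpl : (((A - A) + (A - A) + (A - A) + A).card : ℝ) ≤ K ^ 7 * A.card := by
    have h := Finset.pluennecke_ruzsa_inequality_nsmul_sub_nsmul_sub hA A 4 3
    have e : (A - A) + (A - A) + (A - A) + A = (A + A + A + A) - (A + A + A) := by
      simp only [sub_eq_add_neg, neg_add]
      ac_rfl
    simp only [succ_nsmul, zero_nsmul, zero_add, ← e] at h
    have h' : (((A - A) + (A - A) + (A - A) + A).card : ℝ) ≤
        (((A - A).card : ℝ) / A.card) ^ (4 + 3) * A.card := by
      have := NNRat.cast_mono (K := ℝ) h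
      push_cast at this
      exact this
    refine h'.trans ?_
    gcongr
    rwa [div_le_iff₀ hA0]
  refine Finset.ruzsa_covering_add (K := Z.card * K ^ 7) hA ?_
  calc ((S + A).card : ℝ)
      ≤ ((Z + ((A - A) + (A - A) + (A - A) + A)).card : ℝ) := by
        rw [← add_assoc Z]
        exact_mod_cast Finset.card_le_card (Finset.add_subset_add_right hS)
    _ ≤ Z.card * (((A - A) + (A - A) + (A - A) + A).card : ℝ) := by
        exact_mod_cast Finset.card_add_le
    _ ≤ Z.card * (K ^ 7 * A.card) := by gcongr
    _ = Z.card * K ^ 7 * A.card := by ring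

section Field

variable {F : Type*} [Field F] [DecidableEq F] {A : Finset F} {K : ℝ}

lemma Finset.subset_mul_self_of_one_mem (h1 : (1 : F) ∈ A) : A ⊆ A * A := fun a ha =>
  Finset.mem_mul.2 ⟨a, ha, 1, h1, mul_one a⟩

lemma Finset.card_sub_self_le_of_card_mul_sub_mul_le (h1 : (1 : F) ∈ A)
    (h : ((A * A - A * A).card : ℝ) ≤ K * A.card) : ((A - A).card : ℝ) ≤ K * A.card := by
  refine le_trans ?_ h
  have := Finset.subset_mul_self_of_one_mem h1
  exact_mod_cast Finset.card_le_card (Finset.sub_subset_sub this this)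

lemma Finset.exists_mul_self_subset_add_sub (h1 : (1 : F) ∈ A)
    (h : ((A * A - A * A).card : ℝ) ≤ K * A.card) :
    ∃ X : Finset F, (X.card : ℝ) ≤ K ∧ A * A ⊆ X + (A - A) := by
  have hA : (-A).Nonempty := Finset.Nonempty.neg ⟨1, h1⟩
  obtain ⟨X, -, hX, hAX⟩ := Finset.ruzsa_covering_add (A := A * A) (K := K) hA (by
    rw [← sub_eq_add_neg, Finset.card_neg]
    refine le_trans ?_ h
    exact_mod_cast Finset.card_le_card
      (Finset.sub_subset_sub_left (Finset.subset_mul_self_of_one_mem h1)))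
  refine ⟨X, hX, ?_⟩
  rwa [neg_sub_neg] at hAX

/-- Every dilate of `A` by an element of a product set `A ^ k` is covered by few translates of
`A - A`. -/
lemma Finset.exists_smul_subset_add_sub (h1 : (1 : F) ∈ A) (hK : 1 ≤ K)
    (h : ((A * A - A * A).card : ℝ) ≤ K * A.card) (k : ℕ) :
    ∀ x ∈ A ^ k, ∃ Y : Finset F, (Y.card : ℝ) ≤ K ^ 3 ^ (k + 2) ∧
      ∀ a ∈ A, x * a ∈ Y + (A - A) := by
  induction k with
  | zero =>
    intro x hx
    obtain rfl : x = 1 := by simpa using hx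
    refine ⟨{1}, by simpa using one_le_pow₀ hK, fun a ha => ?_⟩
    exact Finset.mem_add.2 ⟨1, by simp, a - 1, Finset.sub_mem_sub ha h1, by ring⟩
  | succ k ih =>
    intro x hx
    rw [pow_succ] at hx
    obtain ⟨y, hy, b, hb, rfl⟩ := Finset.mem_mul.1 hx
    obtain ⟨Y, hY, hYA⟩ := ih y hy
    obtain ⟨W, hW, hWA⟩ := Finset.exists_mul_self_subset_add_sub h1 h
    have hcov : (A.image (y * b * ·)) ⊆
        (W.image (y * ·) + (Y - Y)) + ((A - A) + (A - A) + (A - A)) := by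
      intro z hz
      obtain ⟨a, ha, rfl⟩ := Finset.mem_image.1 hz
      obtain ⟨w, hw, d, hd, hwd⟩ := Finset.mem_add.1 (hWA (Finset.mul_mem_mul hb ha))
      obtain ⟨p, hp, q, hq, rfl⟩ := Finset.mem_sub.1 hd
      obtain ⟨u, hu, e, he, hue⟩ := Finset.mem_add.1 (hYA p hp)
      obtain ⟨v, hv, f, hf, hvf⟩ := Finset.mem_add.1 (hYA q hq)
      have hf' : -f ∈ A - A := by
        simpa only [neg_sub] using Finset.neg_mem_neg hf
      refine Finset.mem_add.2 ⟨y * w + (u - v), Finset.add_mem_add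
        (Finset.mem_image_of_mem _ hw) (Finset.sub_mem_sub hu hv), e + -f + (1 - 1),
        Finset.add_mem_add (Finset.add_mem_add he hf') (Finset.sub_mem_sub h1 h1), ?_⟩
      linear_combination hue - hvf + y * hwd
    obtain ⟨X, -, hX, hXA⟩ := Finset.exists_subset_add_sub_of_subset_add_three ⟨1, h1⟩
      (Finset.card_sub_self_le_of_card_mul_sub_mul_le h1 h) hcov
    refine ⟨X, hX.trans ?_, fun a ha => hXA (Finset.mem_image_of_mem _ ha)⟩
    have hcard : ((W.image (y * ·) + (Y - Y)).card : ℝ) ≤ W.card * (Y.card * Y.card) := by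
      exact_mod_cast Finset.card_add_le.trans
        (Nat.mul_le_mul Finset.card_image_le Finset.card_sub_le)
    calc ((W.image (y * ·) + (Y - Y)).card : ℝ) * K ^ 7
        ≤ (K * (K ^ 3 ^ (k + 2) * K ^ 3 ^ (k + 2))) * K ^ 7 := by
          gcongr
          exact hcard.trans (by gcongr)
      _ = K ^ (8 + 2 * 3 ^ (k + 2)) := by ring
      _ ≤ K ^ 3 ^ (k + 1 + 2) := by
          refine pow_le_pow_right₀ hK ?_
          have := Nat.one_le_pow k 3 (by norm_num)
          simp only [pow_succ] at *
          omega

/-- If `A * A - A * A` is not much larger than `A`, then each product set `A ^ k` is covered by few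
translates of `A - A`, with centres in `A ^ k`. -/
lemma Finset.exists_pow_subset_add_sub (h1 : (1 : F) ∈ A) (hK : 1 ≤ K)
    (h : ((A * A - A * A).card : ℝ) ≤ K * A.card) (k : ℕ) :
    ∃ X ⊆ A ^ k, (X.card : ℝ) ≤ K ^ 3 ^ (k + 3) ∧ A ^ k ⊆ X + (A - A) := by
  induction k with
  | zero =>
    refine ⟨1, by simp, by simpa using one_le_pow₀ hK, fun a ha => ?_⟩
    exact Finset.mem_add.2 ⟨a, by simpa using ha, 1 - 1, Finset.sub_mem_sub h1 h1, by ring⟩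
  | succ k ih =>
    obtain ⟨X, hXk, hX, hXA⟩ := ih
    obtain ⟨W, hW, hWA⟩ := Finset.exists_mul_self_subset_add_sub h1 h
    choose! Y hY hYA using Finset.exists_smul_subset_add_sub h1 hK h k
    have hcov : A ^ (k + 1) ⊆
        (X.biUnion Y + (W - W)) + ((A - A) + (A - A) + (A - A)) := by
      intro z hz
      rw [pow_succ] at hz
      obtain ⟨y, hy, a, ha, rfl⟩ := Finset.mem_mul.1 hz
      obtain ⟨x, hx, d, hd, rfl⟩ := Finset.mem_add.1 (hXA hy)
      obtain ⟨p, hp, q, hq, rfl⟩ := Finset.mem_sub.1 hd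
      obtain ⟨t, ht, c, hc, htc⟩ := Finset.mem_add.1 (hYA x (hXk hx) a ha)
      obtain ⟨u, hu, e, he, hue⟩ := Finset.mem_add.1 (hWA (Finset.mul_mem_mul hp ha))
      obtain ⟨v, hv, f, hf, hvf⟩ := Finset.mem_add.1 (hWA (Finset.mul_mem_mul hq ha))
      have hf' : -f ∈ A - A := by
        simpa only [neg_sub] using Finset.neg_mem_neg hf
      refine Finset.mem_add.2 ⟨t + (u - v), Finset.add_mem_add
        (Finset.mem_biUnion.2 ⟨x, hx, ht⟩) (Finset.sub_mem_sub hu hv), c + e + -f,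
        Finset.add_mem_add (Finset.add_mem_add hc he) hf', ?_⟩
      linear_combination htc + hue - hvf
    obtain ⟨X', hX'k, hX', hXA'⟩ := Finset.exists_subset_add_sub_of_subset_add_three ⟨1, h1⟩
      (Finset.card_sub_self_le_of_card_mul_sub_mul_le h1 h) hcov
    refine ⟨X', hX'k, hX'.trans ?_, hXA'⟩
    have hU : ((X.biUnion Y).card : ℝ) ≤ X.card * K ^ 3 ^ (k + 2) := by
      calc ((X.biUnion Y).card : ℝ) ≤ ∑ x ∈ X, ((Y x).card : ℝ) := by
            exact_mod_cast Finset.card_biUnion_le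
        _ ≤ X.card • K ^ 3 ^ (k + 2) :=
            Finset.sum_le_card_nsmul _ _ _ fun x hx => hY x (hXk hx)
        _ = X.card * K ^ 3 ^ (k + 2) := nsmul_eq_mul _ _
    have hcard : ((X.biUnion Y + (W - W)).card : ℝ) ≤
        (X.biUnion Y).card * (W.card * W.card) := by
      exact_mod_cast Finset.card_add_le.trans (Nat.mul_le_mul le_rfl Finset.card_sub_le)
    calc ((X.biUnion Y + (W - W)).card : ℝ) * K ^ 7
        ≤ ((K ^ 3 ^ (k + 3) * K ^ 3 ^ (k + 2)) * (K * K)) * K ^ 7 := by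
          gcongr
          refine hcard.trans ?_
          gcongr
          exact hU.trans (by gcongr)
      _ = K ^ (3 ^ (k + 3) + 3 ^ (k + 2) + 9) := by ring
      _ ≤ K ^ 3 ^ (k + 1 + 3) := by
          refine pow_le_pow_right₀ hK ?_
          have := Nat.one_le_pow k 3 (by norm_num)
          simp only [pow_succ] at *
          omega

end Field

theorem product_set_essentially_contained (k : ℕ) :
    ∃ Ck : ℝ, 1 ≤ Ck ∧
      ∀ (F : Type*) [Field F] [DecidableEq F] (A : Finset F), (1 : F) ∈ A →
        ∀ K : ℝ, 1 ≤ K →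
          ((A * A - A * A).card : ℝ) ≤ K * A.card →
          ∃ X : Finset F, (X.card : ℝ) ≤ Ck * K ^ Ck ∧ A ^ k ⊆ X + (A - A) := by
  have hC : (1 : ℝ) ≤ ((3 ^ (k + 3) : ℕ) : ℝ) := by
    exact_mod_cast Nat.one_le_pow _ _ (by norm_num)
  refine ⟨((3 ^ (k + 3) : ℕ) : ℝ), hC, fun F _ _ A h1 K hK h => ?_⟩
  obtain ⟨X, -, hX, hXA⟩ := Finset.exists_pow_subset_add_sub h1 hK h k
  refine ⟨X, ?_, hXA⟩
  rw [Real.rpow_natCast]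
  exact hX.trans (le_mul_of_one_le_left (by positivity) hC)
end

section
/- There exists an absolute constant C > 0 such that: for every δ with 0 < δ < 1, every prime q with F = ℤ/qℤ, and every subset A of F with |A| > |F|^δ, there exist a positive integer k ≤ C/δ and invertible elements ξ₁, …, ξ_k ∈ F \ {0} such that F = A·ξ₁ + ⋯ + A·ξ_k, i.e. every element of F can be written as a₁ξ₁ + ⋯ + a_kξ_k with a₁, …, a_k ∈ A. -/
open Finset in
/-- For distinct pairs there is at most one dilation identifying two sums, and it is nonzero
exactly when both pairs are distinct. -/
lemma card_dilations_identifying_le {F : Type*} [Field F] [Fintype F] [DecidableEq F]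
    (x x' a a' : F) :
    ∑ ξ ∈ univ.erase (0 : F), (if x + ξ * a = x' + ξ * a' then (1 : ℝ) else 0) ≤
      (if x = x' then 1 else 0) * (if a = a' then 1 else 0) * ((Fintype.card F : ℝ) - 1) +
        (1 - if x = x' then 1 else 0) * (1 - if a = a' then 1 else 0) := by
  have hq : 1 ≤ Fintype.card F := Fintype.card_pos
  by_cases hx : x = x' <;> by_cases ha : a = a'
  · simp [hx, ha, card_erase_of_mem, Nat.cast_sub hq]
  · subst hx
    refine (sum_eq_zero fun ξ hξ => ?_).trans_le (by simp [ha])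
    have hξ0 : ξ ≠ 0 := (mem_erase.1 hξ).1
    simp [hξ0, ha]
  · simp [hx, ha]
  · simp only [hx, ha, if_false, sum_boole]
    norm_num
    refine card_le_one.2 fun ξ hξ η hη => ?_
    have h1 := (mem_filter.1 hξ).2
    have h2 := (mem_filter.1 hη).2
    have h : (ξ - η) * (a - a') = 0 := by linear_combination h1 - h2
    rcases mul_eq_zero.1 h with h | h
    · exact sub_eq_zero.1 h
    · exact absurd (sub_eq_zero.1 h) ha

open Finset in
lemma addEnergy_image_mul {F : Type*} [Field F] [DecidableEq F] (X A : Finset F) {ξ : F}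
    (hξ : ξ ≠ 0) :
    (X.addEnergy (A.image (ξ * ·)) : ℝ) =
      ∑ x ∈ X, ∑ x' ∈ X, ∑ a ∈ A, ∑ a' ∈ A,
        if x + ξ * a = x' + ξ * a' then (1 : ℝ) else 0 := by
  have hinj : Function.Injective (ξ * · : F → F) := mul_right_injective₀ hξ
  rw [addEnergy, card_filter]
  push_cast
  simp only [sum_product, sum_image hinj.injOn]

open Finset in
/-- Some nonzero dilate has at most average additive energy. -/
lemma exists_addEnergy_image_mul_le {F : Type*} [Field F] [Fintype F] [DecidableEq F]
    (X A : Finset F) :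
    ∃ ξ : F, ξ ≠ 0 ∧ ((Fintype.card F : ℝ) - 1) * X.addEnergy (A.image (ξ * ·)) ≤
      (X.card : ℝ) * A.card *
        (((Fintype.card F : ℝ) - 1) + ((X.card : ℝ) - 1) * ((A.card : ℝ) - 1)) := by
  have hq : 1 ≤ Fintype.card F := Fintype.card_pos
  set B : ℝ := (X.card : ℝ) * A.card *
        (((Fintype.card F : ℝ) - 1) + ((X.card : ℝ) - 1) * ((A.card : ℝ) - 1)) with hB
  have hcard : ((univ.erase (0 : F)).card : ℝ) = (Fintype.card F : ℝ) - 1 := by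
    simp [card_erase_of_mem, Nat.cast_sub hq]
  have key : ∑ ξ ∈ univ.erase (0 : F), (X.addEnergy (A.image (ξ * ·)) : ℝ) ≤ B := by
    calc ∑ ξ ∈ univ.erase (0 : F), (X.addEnergy (A.image (ξ * ·)) : ℝ)
        = ∑ ξ ∈ univ.erase (0 : F), ∑ x ∈ X, ∑ x' ∈ X, ∑ a ∈ A, ∑ a' ∈ A,
            if x + ξ * a = x' + ξ * a' then (1 : ℝ) else 0 :=
          sum_congr rfl fun ξ hξ => addEnergy_image_mul X A (mem_erase.1 hξ).1
      _ = ∑ x ∈ X, ∑ x' ∈ X, ∑ a ∈ A, ∑ a' ∈ A, ∑ ξ ∈ univ.erase (0 : F),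
            if x + ξ * a = x' + ξ * a' then (1 : ℝ) else 0 := by
          rw [sum_comm]
          refine sum_congr rfl fun x _ => ?_
          rw [sum_comm]
          refine sum_congr rfl fun x' _ => ?_
          rw [sum_comm]
          refine sum_congr rfl fun a _ => ?_
          rw [sum_comm]
      _ ≤ ∑ x ∈ X, ∑ x' ∈ X, ∑ a ∈ A, ∑ a' ∈ A,
            ((if x = x' then 1 else 0) * (if a = a' then 1 else 0) *
                ((Fintype.card F : ℝ) - 1) +
              (1 - if x = x' then 1 else 0) * (1 - if a = a' then 1 else 0)) := by
          gcongr
          exact card_dilations_identifying_le _ _ _ _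
      _ = B := by
          have diag : ∀ S : Finset F, ∑ s ∈ S, ∑ t ∈ S, (if s = t then (1 : ℝ) else 0) =
              S.card := fun S => by simp
          have offd : ∀ S : Finset F, ∑ s ∈ S, ∑ t ∈ S, (1 - if s = t then (1 : ℝ) else 0) =
              S.card * ((S.card : ℝ) - 1) := fun S => by
            simp only [sum_sub_distrib, diag]
            simp
            ring
          simp only [sum_add_distrib, ← mul_sum, ← sum_mul, diag, offd]
          rw [hB]
          ring
  have hne : (univ.erase (0 : F)).Nonempty := ⟨1, by simp⟩
  obtain ⟨ξ, hξ, h⟩ := exists_le_of_sum_le hne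
    (f := fun ξ => ((Fintype.card F : ℝ) - 1) * X.addEnergy (A.image (ξ * ·)))
    (g := fun _ => B) (by
      rw [← mul_sum, sum_const, nsmul_eq_mul, hcard]
      have : (1 : ℝ) ≤ Fintype.card F := by exact_mod_cast hq
      exact mul_le_mul_of_nonneg_left key (by linarith))
  exact ⟨ξ, (mem_erase.1 hξ).1, h⟩

open Finset in
open scoped Pointwise in
/-- Some nonzero dilate of `A` has a large sumset with `X`. -/
lemma exists_card_add_image_mul_ge {F : Type*} [Field F] [Fintype F] [DecidableEq F]
    {X A : Finset F} (hX : X.Nonempty) (hA : A.Nonempty) :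
    ∃ ξ : F, ξ ≠ 0 ∧ (X.card : ℝ) * A.card * ((Fintype.card F : ℝ) - 1) ≤
      (X + A.image (ξ * ·)).card *
        (((Fintype.card F : ℝ) - 1) + ((X.card : ℝ) - 1) * ((A.card : ℝ) - 1)) := by
  obtain ⟨ξ, hξ, h⟩ := exists_addEnergy_image_mul_le X A
  refine ⟨ξ, hξ, ?_⟩
  have hinj : Function.Injective (ξ * · : F → F) := mul_right_injective₀ hξ
  have cs := le_card_add_mul_addEnergy X (A.image (ξ * ·))
  rw [card_image_of_injective _ hinj] at cs
  have cs' : (X.card : ℝ) ^ 2 * (A.card : ℝ) ^ 2 ≤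
      (X + A.image (ξ * ·)).card * X.addEnergy (A.image (ξ * ·)) := by exact_mod_cast cs
  have hq : (1 : ℝ) ≤ Fintype.card F := by exact_mod_cast Fintype.card_pos (α := F)
  have hxa : (0 : ℝ) < (X.card : ℝ) * A.card := by
    have := hX.card_pos
    have := hA.card_pos
    positivity
  refine le_of_mul_le_mul_left ?_ hxa
  have h1 := mul_le_mul_of_nonneg_left cs' (sub_nonneg.2 hq)
  have h2 := mul_le_mul_of_nonneg_left h
    (Nat.cast_nonneg (α := ℝ) (X + A.image (ξ * ·)).card)
  nlinarith

/-- Every element of `S` is a combination of `k` elements of `A`, with fixed nonzero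
coefficients. -/
def IsDilateSum {F : Type*} [Field F] (A : Finset F) (k : ℕ) (S : Finset F) : Prop :=
  ∃ ξ : Fin k → F, (∀ i, ξ i ≠ 0) ∧
    ∀ x ∈ S, ∃ a : Fin k → F, (∀ i, a i ∈ A) ∧ ∑ i, a i * ξ i = x

lemma isDilateSum_one {F : Type*} [Field F] (A : Finset F) : IsDilateSum A 1 A :=
  ⟨fun _ => 1, fun _ => one_ne_zero, fun x hx => ⟨fun _ => x, fun _ => hx, by simp⟩⟩

open scoped Pointwise in
lemma IsDilateSum.add_image_mul {F : Type*} [Field F] [DecidableEq F] {A S T : Finset F}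
    {k l : ℕ} (hS : IsDilateSum A k S) (hT : IsDilateSum A l T) {ξ : F} (hξ : ξ ≠ 0) :
    IsDilateSum A (k + l) (S + T.image (ξ * ·)) := by
  obtain ⟨u, hu, hS⟩ := hS
  obtain ⟨v, hv, hT⟩ := hT
  refine ⟨Fin.append u fun i => ξ * v i, ?_, ?_⟩
  · intro i
    refine Fin.addCases (fun i => ?_) (fun i => ?_) i
    · simpa using hu i
    · simpa using ⟨hξ, hv i⟩
  · intro x hx
    obtain ⟨s, hs, t', ht', rfl⟩ := Finset.mem_add.1 hx
    obtain ⟨t, ht, rfl⟩ := Finset.mem_image.1 ht'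
    obtain ⟨a, ha, rfl⟩ := hS s hs
    obtain ⟨b, hb, rfl⟩ := hT t ht
    refine ⟨Fin.append a b, ?_, ?_⟩
    · intro i
      refine Fin.addCases (fun i => ?_) (fun i => ?_) i
      · simpa using ha i
      · simpa using hb i
    · simp only [Fin.sum_univ_add, Fin.append_left, Fin.append_right, Finset.mul_sum]
      congr 1
      exact Finset.sum_congr rfl fun i _ => by ring

open scoped Pointwise in
/-- Below the square root of the field size, sums of dilates of `A` grow at each step by a factor
of at least the square root of `A.card`. -/
lemma exists_isDilateSum_card_sq_ge {F : Type*} [Field F] [Fintype F] [DecidableEq F]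
    {A : Finset F} (hA : A.Nonempty) (n : ℕ) :
    ∃ S : Finset F, S.Nonempty ∧ IsDilateSum A (n + 1) S ∧
      (Fintype.card F < S.card ^ 2 ∨ A.card ^ (n + 1) ≤ S.card ^ 2) := by
  have ha1 : 1 ≤ A.card := hA.card_pos
  induction n with
  | zero => exact ⟨A, hA, isDilateSum_one A, Or.inr (Nat.pow_le_pow_right ha1 (by norm_num))⟩
  | succ n ih =>
    obtain ⟨S, hS, hSA, h⟩ := ih
    obtain ⟨ξ, hξ, hcard⟩ := exists_card_add_image_mul_ge hS hA
    refine ⟨_, hS.add (hA.image _), hSA.add_image_mul (isDilateSum_one A) hξ, ?_⟩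
    set Y := S + A.image (ξ * ·) with hY
    have hmono : S.card ≤ Y.card := Finset.card_le_card_add_right (hA.image _)
    by_cases hlt : Fintype.card F < S.card ^ 2
    · exact Or.inl (hlt.trans_le (Nat.pow_le_pow_left hmono 2))
    refine Or.inr ?_
    have h' := h.resolve_left hlt
    have hs1 : (1 : ℝ) ≤ S.card := by exact_mod_cast hS.card_pos
    have hq1 : (1 : ℝ) < Fintype.card F := by exact_mod_cast Fintype.one_lt_card (α := F)
    have haq : (A.card : ℝ) ≤ Fintype.card F := by exact_mod_cast A.card_le_univ
    have hsq : (S.card : ℝ) ^ 2 ≤ Fintype.card F := by exact_mod_cast not_lt.1 hlt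
    have hr1 : 1 ≤ √(A.card : ℝ) := Real.one_le_sqrt.2 (by exact_mod_cast ha1)
    have hr2 : √(A.card : ℝ) ^ 2 = A.card := Real.sq_sqrt (Nat.cast_nonneg _)
    have hrt : √(A.card : ℝ) ≤ √(Fintype.card F : ℝ) := Real.sqrt_le_sqrt haq
    have ht2 : √(Fintype.card F : ℝ) ^ 2 = Fintype.card F := Real.sq_sqrt (Nat.cast_nonneg _)
    have hst : (S.card : ℝ) ≤ √(Fintype.card F : ℝ) := Real.le_sqrt_of_sq_le hsq
    have hgrow : (S.card : ℝ) * √(A.card : ℝ) ≤ Y.card := by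
      set r := √(A.card : ℝ)
      set t := √(Fintype.card F : ℝ)
      have hY0 : (0 : ℝ) ≤ Y.card := Nat.cast_nonneg _
      rw [← hr2, ← ht2] at hcard
      rw [← ht2] at hq1
      have h1 : ((S.card : ℝ) - 1) * (r + 1) ≤ t ^ 2 - 1 := by
        nlinarith [mul_le_mul (sub_le_sub_right hst 1) (add_le_add_left hrt 1)
          (by linarith) (by linarith)]
      have h2 : (t ^ 2 - 1) + ((S.card : ℝ) - 1) * (r ^ 2 - 1) ≤ r * (t ^ 2 - 1) := by
        nlinarith [mul_le_mul_of_nonneg_right h1 (sub_nonneg.2 hr1)]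
      have h3 := hcard.trans (mul_le_mul_of_nonneg_left h2 hY0)
      have hpos : 0 < r * (t ^ 2 - 1) := mul_pos (by linarith) (by linarith)
      refine le_of_mul_le_mul_right ?_ hpos
      linarith
    have hgrow2 : (S.card : ℝ) ^ 2 * A.card ≤ (Y.card : ℝ) ^ 2 := by
      rw [← hr2, ← mul_pow]
      exact pow_le_pow_left₀ (by positivity) hgrow 2
    have hgrow3 : S.card ^ 2 * A.card ≤ Y.card ^ 2 := by exact_mod_cast hgrow2
    calc A.card ^ (n + 1 + 1) = A.card ^ (n + 1) * A.card := pow_succ _ _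
      _ ≤ S.card ^ 2 * A.card := Nat.mul_le_mul_right _ h'
      _ ≤ Y.card ^ 2 := hgrow3

open scoped Pointwise in
lemma exists_card_lt_two_mul_card_add_image_mul {F : Type*} [Field F] [Fintype F]
    [DecidableEq F] {S : Finset F} (hS : Fintype.card F < S.card ^ 2) :
    ∃ ξ : F, ξ ≠ 0 ∧ Fintype.card F < 2 * (S + S.image (ξ * ·)).card := by
  have hne : S.Nonempty := by
    rw [Finset.nonempty_iff_ne_empty]
    rintro rfl
    simp at hS
  obtain ⟨ξ, hξ, h⟩ := exists_card_add_image_mul_ge hne hne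
  refine ⟨ξ, hξ, ?_⟩
  have hq1 : (1 : ℝ) < Fintype.card F := by exact_mod_cast Fintype.one_lt_card (α := F)
  have hsF : (S.card : ℝ) ≤ Fintype.card F := by exact_mod_cast S.card_le_univ
  have hsq : (Fintype.card F : ℝ) < (S.card : ℝ) ^ 2 := by exact_mod_cast hS
  have hs1 : (1 : ℝ) ≤ S.card := by exact_mod_cast hne.card_pos
  suffices (Fintype.card F : ℝ) < 2 * (S + S.image (ξ * ·)).card by exact_mod_cast this
  set s := (S.card : ℝ)
  set f := (Fintype.card F : ℝ)
  set y := ((S + S.image (ξ * ·)).card : ℝ)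
  have hD : 0 < (f - 1) + (s - 1) * (s - 1) := by nlinarith
  by_contra! hcon
  have h1 : 2 * (s * s * (f - 1)) ≤ f * ((f - 1) + (s - 1) * (s - 1)) := by nlinarith
  nlinarith

open scoped Pointwise in
lemma Finset.add_self_eq_univ_of_card_lt {G : Type*} [AddCommGroup G] [Fintype G]
    [DecidableEq G] {S : Finset G} (hS : Fintype.card G < 2 * S.card) (x : G) : x ∈ S + S := by
  have hinj : Function.Injective (x - · : G → G) := sub_right_injective
  have hmeet : (S ∩ S.image (x - ·)).Nonempty := by
    rw [← Finset.card_pos]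
    have h1 := Finset.card_union_add_card_inter S (S.image (x - ·))
    rw [Finset.card_image_of_injective _ hinj] at h1
    have h2 := (S ∪ S.image (x - ·)).card_le_univ
    omega
  obtain ⟨s, hs⟩ := hmeet
  obtain ⟨hs, hs'⟩ := Finset.mem_inter.1 hs
  obtain ⟨t, ht, rfl⟩ := Finset.mem_image.1 hs'
  exact Finset.mem_add.2 ⟨_, hs, t, ht, sub_add_cancel x t⟩

theorem linear_surjection_from_Ak :
    ∃ C : ℝ, 0 < C ∧
      ∀ δ : ℝ, 0 < δ → δ < 1 →
        ∀ q : ℕ, q.Prime → ∀ A : Finset (ZMod q),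
          (q : ℝ) ^ δ < (A.card : ℝ) →
          ∃ k : ℕ, 0 < k ∧ (k : ℝ) ≤ C / δ ∧
            ∃ ξ : Fin k → ZMod q, (∀ i, ξ i ≠ 0) ∧
              ∀ x : ZMod q, ∃ a : Fin k → ZMod q,
                (∀ i, a i ∈ A) ∧ ∑ i, a i * ξ i = x := by
  refine ⟨8, by norm_num, fun δ hδ hδ1 q hq A hAcard => ?_⟩
  have : Fact q.Prime := ⟨hq⟩
  have hq0 : (0 : ℝ) < q := by exact_mod_cast hq.pos
  have hq1 : (1 : ℝ) ≤ q := by exact_mod_cast hq.one_lt.le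
  have hA : A.Nonempty := by
    rw [← Finset.card_pos]
    exact_mod_cast (Real.rpow_pos_of_pos hq0 δ).trans hAcard
  set n := ⌊1 / δ⌋₊ with hn
  have hn_le : (n : ℝ) ≤ 1 / δ := Nat.floor_le (by positivity)
  have hn_lt : 1 / δ < n + 1 := Nat.lt_floor_add_one _
  have hpow : q < A.card ^ (n + 1) := by
    have h1 : (q : ℝ) ≤ ((q : ℝ) ^ δ) ^ (n + 1) := by
      rw [← Real.rpow_natCast, ← Real.rpow_mul hq0.le]
      refine Real.self_le_rpow_of_one_le hq1 ?_
      push_cast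
      rw [div_lt_iff₀ hδ] at hn_lt
      linarith
    have h2 : ((q : ℝ) ^ δ) ^ (n + 1) < (A.card : ℝ) ^ (n + 1) :=
      pow_lt_pow_left₀ hAcard (by positivity) (by omega)
    exact_mod_cast h1.trans_lt h2
  obtain ⟨S, -, hSA, hS⟩ := exists_isDilateSum_card_sq_ge hA n
  have hS' : Fintype.card (ZMod q) < S.card ^ 2 := by
    rcases hS with h | h
    · exact h
    · rw [ZMod.card]
      exact hpow.trans_le h
  obtain ⟨ξ, hξ, hT⟩ := exists_card_lt_two_mul_card_add_image_mul hS'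
  have hTA := hSA.add_image_mul hSA hξ
  obtain ⟨η, hη, hrep⟩ := hTA.add_image_mul hTA one_ne_zero
  refine ⟨_, by omega, ?_, η, hη, fun x => hrep x ?_⟩
  · have : 1 ≤ 1 / δ := by rw [le_div_iff₀ hδ]; linarith
    push_cast
    rw [show (8 : ℝ) / δ = 8 * (1 / δ) by ring]
    linarith
  · simpa using Finset.add_self_eq_univ_of_card_lt hT x
end

section
/- Let q be a prime and F = ℤ/qℤ. Let B be a non-empty subset of F, let k > 1 be an integer, and suppose there exist ξ₁, …, ξ_k ∈ F such that the map B^k → F, (b₁,…,b_k) ↦ Σ_{j≤k} b_j ξ_j, is surjective. Let B̃ := B·(B−B) + B·(B−B) = {b₁(b₂−b₃) + b₄(b₅−b₆) : b₁,…,b₆ ∈ B}. Then there exist η₁, …, η_{k−1} ∈ F such that the map B̃^{k−1} → F, (c₁,…,c_{k−1}) ↦ Σ_{j≤k−1} c_j η_j, is surjective. -/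
open Pointwise

/-- A linear surjection `B ^ k → ZMod q` with `q` prime and `k > 1` cannot be injective, as
otherwise `q = |B| ^ k`. -/
theorem exists_ne_sum_mul_eq_of_surjective {q : ℕ} (hq : q.Prime) (B : Finset (ZMod q))
    {k : ℕ} (hk : 1 < k) (ξ : Fin k → ZMod q)
    (hsurj : ∀ x : ZMod q, ∃ b : Fin k → ZMod q, (∀ i, b i ∈ B) ∧ ∑ i, b i * ξ i = x) :
    ∃ b b' : Fin k → ZMod q, (∀ i, b i ∈ B) ∧ (∀ i, b' i ∈ B) ∧ b ≠ b' ∧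
      ∑ i, b i * ξ i = ∑ i, b' i * ξ i := by
  by_contra! hinj
  have hbij : Function.Bijective
      (fun b : Fin k → B => ∑ i, (b i : ZMod q) * ξ i) := by
    refine ⟨fun b b' h => ?_, fun x => ?_⟩
    · by_contra hne
      refine hinj (fun i => b i) (fun i => b' i) (fun i => (b i).2) (fun i => (b' i).2) ?_ h
      exact fun h' => hne (funext fun i => Subtype.ext (congrFun h' i))
    · obtain ⟨b, hb, hx⟩ := hsurj x
      exact ⟨fun i => ⟨b i, hb i⟩, hx⟩
  have hcard := Nat.card_eq_of_bijective _ hbij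
  rw [Nat.card_fun, Nat.card_fin, Nat.card_zmod] at hcard
  exact Nat.Prime.not_prime_pow hk (hcard ▸ hq)

theorem rank_reduction (q : ℕ) (hq : q.Prime) (B : Finset (ZMod q)) (hB : B.Nonempty)
    (k : ℕ) (hk : 1 < k) (ξ : Fin k → ZMod q)
    (hsurj : ∀ x : ZMod q, ∃ b : Fin k → ZMod q,
      (∀ i, b i ∈ B) ∧ ∑ i, b i * ξ i = x) :
    ∃ η : Fin (k - 1) → ZMod q,
      ∀ x : ZMod q, ∃ c : Fin (k - 1) → ZMod q,
        (∀ i, c i ∈ B * (B - B) + B * (B - B)) ∧ ∑ i, c i * η i = x := by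
  have : Fact q.Prime := ⟨hq⟩
  obtain ⟨b, b', hb, hb', hne, heq⟩ := exists_ne_sum_mul_eq_of_surjective hq B hk ξ hsurj
  obtain ⟨i₀, hi₀⟩ := Function.ne_iff.mp hne
  obtain ⟨n, rfl⟩ : ∃ n, k = n + 1 := ⟨k - 1, by lia⟩
  have hd : b i₀ - b' i₀ ≠ 0 := sub_ne_zero.mpr hi₀
  rw [Nat.add_sub_cancel]
  -- The relation `heq` lets us eliminate `ξ i₀` after multiplying by `b i₀ - b' i₀`.
  refine ⟨fun j => ξ (i₀.succAbove j) / (b i₀ - b' i₀), fun x => ?_⟩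
  obtain ⟨a, ha, rfl⟩ := hsurj x
  refine ⟨fun j => a (i₀.succAbove j) * (b i₀ - b' i₀) +
    a i₀ * (b' (i₀.succAbove j) - b (i₀.succAbove j)), fun j => ?_, ?_⟩
  · exact Finset.add_mem_add
      (Finset.mul_mem_mul (ha _) (Finset.sub_mem_sub (hb _) (hb' _)))
      (Finset.mul_mem_mul (ha _) (Finset.sub_mem_sub (hb' _) (hb _)))
  · rw [Fin.sum_univ_succAbove _ i₀, Fin.sum_univ_succAbove _ i₀] at heq
    rw [Fin.sum_univ_succAbove _ i₀]
    simp only [← mul_div_assoc, ← Finset.sum_div]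
    rw [div_eq_iff hd]
    simp only [add_mul, sub_mul, mul_sub, Finset.sum_add_distrib, Finset.sum_sub_distrib,
      mul_assoc, mul_left_comm _ (b i₀), mul_left_comm _ (b' i₀), ← Finset.mul_sum]
    linear_combination (-a i₀) * heq
end

section
/- For every δ with 0 < δ < 1 there exists a constant C(δ) > 0 such that: for every finite field F, every subset A of F with |A| > |F|^δ, and every real K ≥ 2 with |A+A| ≤ K·|A| and |A·A| ≤ K·|A|, there exist a subfield G of F with |G| ≤ K^{C(δ)}·|A|, a non-zero element ξ ∈ F \ {0}, and a set X ⊆ F with |X| ≤ K^{C(δ)}, such that A ⊆ ξ·G ∪ X. -/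
open Pointwise

section Collisions

variable {α β : Type*} [DecidableEq β]

/-- Cauchy–Schwarz: a map with small image has many collisions. -/
lemma sq_card_le_card_image_mul_card_collisions (s : Finset α) (f : α → β) :
    s.card ^ 2 ≤ (s.image f).card * ((s ×ˢ s).filter fun p => f p.1 = f p.2).card := by
  have h1 : s.card = ∑ b ∈ s.image f, (s.filter fun a => f a = b).card :=
    Finset.card_eq_sum_card_image f s
  have h2 : ((s ×ˢ s).filter fun p => f p.1 = f p.2).card
      = ∑ b ∈ s.image f, (s.filter fun a => f a = b).card ^ 2 := by
    rw [Finset.card_eq_sum_card_fiberwise (f := fun p => f p.1) (t := s.image f)]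
    · refine Finset.sum_congr rfl fun b _ => ?_
      rw [sq, ← Finset.card_product]
      congr 1
      ext p
      simp only [Finset.mem_filter, Finset.mem_product]
      constructor
      · rintro ⟨⟨⟨h, h'⟩, e⟩, e'⟩
        exact ⟨⟨h, e'⟩, h', e ▸ e'⟩
      · rintro ⟨⟨h, e⟩, h', e'⟩
        exact ⟨⟨⟨h, h'⟩, e.trans e'.symm⟩, e⟩
    · intro p hp
      simp only [Finset.coe_filter, Finset.mem_product, Set.mem_ofPred_eq] at hp
      exact Finset.mem_coe.2 (Finset.mem_image_of_mem f hp.1.1)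
  rw [h2]
  calc s.card ^ 2 = (∑ b ∈ s.image f, (s.filter fun a => f a = b).card) ^ 2 := by rw [← h1]
    _ ≤ _ := by exact_mod_cast sq_sum_le_card_mul_sum_sq

end Collisions

section Dilates

variable {F : Type*} [Field F] [DecidableEq F]

/-- `x` is an `M`-good dilation factor for `A` when `A + x • A` is at most `M` times as large
as `A`. -/
def GoodDilate (A : Finset F) (M : ℝ) (x : F) : Prop :=
  ((A + x • A).card : ℝ) ≤ M * A.card

variable {A : Finset F} {K M N : ℝ} {x y : F}

lemma GoodDilate.mono (h : GoodDilate A M x) (hMN : M ≤ N) : GoodDilate A N x :=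
  le_trans h (by gcongr)

lemma GoodDilate.one_le (hA : A.Nonempty) (h : GoodDilate A M x) : 1 ≤ M := by
  have h1 : A.card ≤ (A + x • A).card :=
    Finset.card_le_card_add_right hA.smul_finset
  have h2 : (A.card : ℝ) ≤ M * A.card := le_trans (by exact_mod_cast h1) h
  have h3 : (0 : ℝ) < A.card := by exact_mod_cast hA.card_pos
  nlinarith

lemma goodDilate_zero (hA : A.Nonempty) : GoodDilate A 1 (0 : F) := by
  simp [GoodDilate, Finset.zero_smul_finset hA]

lemma GoodDilate.inv (h : GoodDilate A M x) : GoodDilate A M x⁻¹ := by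
  rcases eq_or_ne x 0 with rfl | hx
  · simpa using h
  unfold GoodDilate at *
  have : x • (A + x⁻¹ • A) = A + x • A := by
    rw [smul_add, smul_smul, mul_inv_cancel₀ hx, one_smul, add_comm]
  rwa [← this, Finset.card_smul_finset₀ hx] at h

lemma GoodDilate.mul (hA : A.Nonempty) (hx : GoodDilate A M x) (hy : GoodDilate A N y) :
    GoodDilate A (M * N) (x * y) := by
  have hM := hx.one_le hA
  have hN := hy.one_le hA
  rcases eq_or_ne x 0 with rfl | hx0
  · rw [zero_mul]
    exact (goodDilate_zero hA).mono (by nlinarith)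
  have h1 := Finset.ruzsa_triangle_inequality_add_add_add A (x • A) ((x * y) • A)
  have h2 : x • A + (x * y) • A = x • (A + y • A) := by rw [smul_add, smul_smul]
  rw [h2, Finset.card_smul_finset₀ hx0, Finset.card_smul_finset₀ hx0] at h1
  have h3 : (0 : ℝ) < A.card := by exact_mod_cast hA.card_pos
  have h4 : ((A + (x * y) • A).card : ℝ) * A.card ≤ (A + x • A).card * (A + y • A).card := by
    exact_mod_cast h1
  refine le_of_mul_le_mul_right (h4.trans ?_) h3
  calc ((A + x • A).card : ℝ) * (A + y • A).card ≤ (M * A.card) * (N * A.card) := by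
        gcongr
        · exact hx
        · exact hy
    _ = _ := by ring

lemma goodDilate_neg_one (hA : A.Nonempty) (hK : ((A + A).card : ℝ) ≤ K * A.card) :
    GoodDilate A (K ^ 2) (-1 : F) := by
  have h1 := Finset.ruzsa_triangle_inequality_sub_add_add A A A
  have h2 : A + (-1 : F) • A = A - A := by
    rw [sub_eq_add_neg]
    congr 1
    ext z
    simp
  have h3 : (0 : ℝ) < A.card := by exact_mod_cast hA.card_pos
  have h4 : ((A - A).card : ℝ) * A.card ≤ (A + A).card * (A + A).card := by exact_mod_cast h1
  unfold GoodDilate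
  rw [h2]
  refine le_of_mul_le_mul_right (h4.trans ?_) h3
  calc ((A + A).card : ℝ) * (A + A).card ≤ (K * A.card) * (K * A.card) :=
        mul_le_mul hK hK (Nat.cast_nonneg _) ((Nat.cast_nonneg _).trans hK)
    _ = _ := by ring

lemma GoodDilate.add (hA : A.Nonempty) (hK : ((A + A).card : ℝ) ≤ K * A.card)
    (hx : GoodDilate A M x) (hy : GoodDilate A N y) :
    GoodDilate A (M * N * K ^ 5) (x + y) := by
  have hM := hx.one_le hA
  have h3 : (0 : ℝ) < A.card := by exact_mod_cast hA.card_pos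
  unfold GoodDilate at hx hy ⊢
  rw [add_comm A] at hx hy
  obtain ⟨S, -, hS, hxS⟩ := Finset.ruzsa_covering_add hA hx
  obtain ⟨T, -, hT, hyT⟩ := Finset.ruzsa_covering_add hA hy
  have hsub : A + (x + y) • A ⊆ (S + T) + (3 • A - 2 • A) := by
    have h5 : (x + y) • A ⊆ x • A + y • A := by
      intro z hz
      obtain ⟨a, ha, rfl⟩ := Finset.mem_smul_finset.1 hz
      rw [add_smul]
      exact Finset.add_mem_add (Finset.smul_mem_smul_finset ha) (Finset.smul_mem_smul_finset ha)
    calc A + (x + y) • A ⊆ A + ((S + (A - A)) + (T + (A - A))) :=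
          Finset.add_subset_add_left (h5.trans (Finset.add_subset_add hxS hyT))
      _ = (S + T) + (3 • A - 2 • A) := by
          rw [show (3 • A : Finset F) = A + A + A by rw [succ_nsmul, two_nsmul],
            show (2 • A : Finset F) = A + A from two_nsmul A]
          simp only [sub_eq_add_neg, neg_add]
          ac_rfl
  have hP := Finset.pluennecke_ruzsa_inequality_nsmul_sub_nsmul_add hA A 3 2
  have hP' : ((3 • A - 2 • A).card : ℝ) ≤ ((A + A).card / A.card : ℝ) ^ 5 * A.card := by
    have := (NNRat.cast_le (K := ℝ)).2 hP
    push_cast at this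
    exact this
  have hK' : ((A + A).card / A.card : ℝ) ≤ K := by rwa [div_le_iff₀ h3]
  calc ((A + (x + y) • A).card : ℝ) ≤ ((S + T) + (3 • A - 2 • A)).card := by
        exact_mod_cast Finset.card_le_card hsub
    _ ≤ (S.card * T.card : ℝ) * (3 • A - 2 • A).card := by
        exact_mod_cast Finset.card_add_le.trans (Nat.mul_le_mul_right _ Finset.card_add_le)
    _ ≤ (M * N) * (K ^ 5 * A.card) := by
        have hMN : (S.card : ℝ) * T.card ≤ M * N := by gcongr
        have hPK := hP'.trans (show _ ≤ K ^ 5 * (A.card : ℝ) by gcongr)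
        exact mul_le_mul hMN hPK (Nat.cast_nonneg _)
          ((mul_nonneg (Nat.cast_nonneg _) (Nat.cast_nonneg _)).trans hMN)
    _ = _ := by ring

/-- A set with small product set contains many elements whose dilates overlap substantially with
a fixed dilate. -/
lemma exists_popular_dilate (hA : A.Nonempty) (h0 : (0 : F) ∉ A) (hK0 : 0 < K)
    (hK : ((A * A).card : ℝ) ≤ K * A.card) :
    ∃ b ∈ A, ∃ A' ⊆ A, (A.card : ℝ) ≤ 2 * K * A'.card ∧
      ∀ a ∈ A', (A.card : ℝ) ≤ 2 * K * (a • A ∩ b • A).card := by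
  have hn : (0 : ℝ) < A.card := by exact_mod_cast hA.card_pos
  have h1 := sq_card_le_card_image_mul_card_collisions (A ×ˢ A) (fun p : F × F => p.1 * p.2)
  set E := ((A ×ˢ A) ×ˢ (A ×ˢ A)).filter
    fun p : (F × F) × (F × F) => p.1.1 * p.1.2 = p.2.1 * p.2.2 with hE
  rw [Finset.card_product, Finset.image_mul_product] at h1
  have h2 : E.card ≤ ∑ b ∈ A, ∑ a ∈ A, (a • A ∩ b • A).card := by
    rw [← Finset.sum_product' A A (fun b a => (a • A ∩ b • A).card),
      Finset.card_eq_sum_card_fiberwise (f := fun p => (p.2.1, p.1.1)) (t := A ×ˢ A)]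
    · refine Finset.sum_le_sum fun q hq => ?_
      obtain ⟨b, a⟩ := q
      simp only [Finset.mem_product] at hq
      have ha : a ≠ 0 := fun h => h0 (h ▸ hq.2)
      have hb : b ≠ 0 := fun h => h0 (h ▸ hq.1)
      refine Finset.card_le_card_of_injOn (fun p => a * p.1.2) ?_ ?_
      · rintro ⟨⟨p1, p2⟩, p3, p4⟩ hp
        simp only [hE, Finset.coe_filter, Finset.mem_filter, Finset.mem_product, Prod.mk.injEq,
          Set.mem_ofPred_eq] at hp
        obtain ⟨⟨⟨⟨m1, m2⟩, m3, m4⟩, e⟩, rfl, rfl⟩ := hp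
        simp only [Finset.coe_inter, Set.mem_inter_iff, Finset.mem_coe]
        refine ⟨Finset.smul_mem_smul_finset m2, ?_⟩
        rw [e]
        exact Finset.smul_mem_smul_finset m4
      · rintro ⟨⟨p1, p2⟩, p3, p4⟩ hp ⟨⟨q1, q2⟩, q3, q4⟩ hq' e'
        simp only [hE, Finset.coe_filter, Finset.mem_filter, Finset.mem_product, Prod.mk.injEq,
          Set.mem_ofPred_eq] at hp hq' e'
        obtain ⟨⟨-, e1⟩, rfl, rfl⟩ := hp
        obtain ⟨⟨-, e2⟩, rfl, rfl⟩ := hq'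
        have e3 := mul_left_cancel₀ ha e'
        subst e3
        have e4 := mul_left_cancel₀ hb (e1.symm.trans e2)
        rw [e4]
    · rintro ⟨⟨p1, p2⟩, p3, p4⟩ hp
      simp only [hE, Finset.coe_filter, Finset.mem_product, Set.mem_ofPred_eq] at hp
      simp [hp.1.1.1, hp.1.2.1]
  have h3 : (A.card : ℝ) ^ 3 ≤ K * ∑ b ∈ A, ∑ a ∈ A, ((a • A ∩ b • A).card : ℝ) := by
    have h4 : ((A.card : ℝ) * A.card) ^ 2 ≤ (A * A).card * E.card := by exact_mod_cast h1
    have h5 : (E.card : ℝ) ≤ ∑ b ∈ A, ∑ a ∈ A, ((a • A ∩ b • A).card : ℝ) := by exact_mod_cast h2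
    have h6 : ((A.card : ℝ) * A.card) ^ 2 ≤
        (K * A.card) * ∑ b ∈ A, ∑ a ∈ A, ((a • A ∩ b • A).card : ℝ) :=
      h4.trans (by gcongr)
    refine le_of_mul_le_mul_left ?_ hn
    linarith
  obtain ⟨b, hb, hb'⟩ := Finset.exists_le_of_sum_le hA
    (f := fun _ => (A.card : ℝ) ^ 2 / K) (g := fun b => ∑ a ∈ A, ((a • A ∩ b • A).card : ℝ))
    (by
      rw [Finset.sum_const, nsmul_eq_mul, ← mul_div_assoc, div_le_iff₀ hK0]
      linarith)
  refine ⟨b, hb, A.filter fun a => (A.card : ℝ) ≤ 2 * K * (a • A ∩ b • A).card,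
    Finset.filter_subset _ _, ?_, fun a ha => (Finset.mem_filter.1 ha).2⟩
  set A' := A.filter fun a => (A.card : ℝ) ≤ 2 * K * (a • A ∩ b • A).card
  have h7 : ∑ a ∈ A, ((a • A ∩ b • A).card : ℝ) ≤
      A'.card * A.card + A.card * (A.card / (2 * K)) := by
    calc ∑ a ∈ A, ((a • A ∩ b • A).card : ℝ)
        ≤ ∑ a ∈ A, ((if (A.card : ℝ) ≤ 2 * K * (a • A ∩ b • A).card then (A.card : ℝ) else 0)
            + A.card / (2 * K)) := by
          refine Finset.sum_le_sum fun a _ => ?_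
          split_ifs with h
          · have : ((a • A ∩ b • A).card : ℝ) ≤ A.card := by
              have := (Finset.card_le_card (Finset.inter_subset_left (s₁ := a • A)
                (s₂ := b • A))).trans Finset.card_smul_finset_le
              exact_mod_cast this
            have : 0 ≤ (A.card : ℝ) / (2 * K) := by positivity
            linarith
          · rw [zero_add, le_div_iff₀ (by positivity)]
            linarith
      _ = _ := by
          rw [Finset.sum_add_distrib, Finset.sum_const, nsmul_eq_mul, ← Finset.sum_filter,
            Finset.sum_const, nsmul_eq_mul]
  have h8 := hb'.trans h7
  rw [div_le_iff₀ hK0] at h8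
  have h9 : (A'.card * A.card + A.card * (A.card / (2 * K))) * K
      = A'.card * A.card * K + (A.card : ℝ) ^ 2 / 2 := by
    field_simp
  rw [h9] at h8
  refine le_of_mul_le_mul_left ?_ hn
  linarith

/-- If the dilates of `A` by `a` and `b` overlap substantially, then `a / b` is a good dilation
factor. -/
lemma goodDilate_div {a b : F} (hb : b ≠ 0) (hA : A.Nonempty) (hK0 : 0 < K)
    (hK : ((A + A).card : ℝ) ≤ K * A.card)
    (h : (A.card : ℝ) ≤ M * (a • A ∩ b • A).card) : GoodDilate A (M * K ^ 2) (a / b) := by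
  have hn : (0 : ℝ) < A.card := by exact_mod_cast hA.card_pos
  set D := a • A ∩ b • A
  have hD : (0 : ℝ) < D.card := by
    refine (Nat.cast_nonneg _).lt_of_ne fun h' => ?_
    rw [← h', mul_zero] at h
    linarith
  have h1 := Finset.ruzsa_triangle_inequality_add_add_add (b • A) D (a • A)
  have h2 : (b • A + D).card ≤ (A + A).card := by
    refine (Finset.card_le_card (Finset.add_subset_add_left Finset.inter_subset_right)).trans ?_
    rw [← smul_add]
    exact Finset.card_smul_finset_le
  have h3 : (D + a • A).card ≤ (A + A).card := by
    refine (Finset.card_le_card (Finset.add_subset_add_right Finset.inter_subset_left)).trans ?_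
    rw [← smul_add]
    exact Finset.card_smul_finset_le
  have h4 : b • A + a • A = b • (A + (a / b) • A) := by
    rw [smul_add, smul_smul, mul_div_cancel₀ _ hb]
  rw [h4, Finset.card_smul_finset₀ hb] at h1
  have h5 : ((A + (a / b) • A).card : ℝ) * D.card ≤ (K * A.card) * (K * A.card) := by
    calc ((A + (a / b) • A).card : ℝ) * D.card ≤ (A + A).card * (A + A).card := by
          exact_mod_cast h1.trans (Nat.mul_le_mul h2 h3)
      _ ≤ _ := by gcongr
  refine le_of_mul_le_mul_right (h5.trans ?_) hD
  calc (K * A.card) * (K * A.card) ≤ (K * A.card) * (K * (M * D.card)) := by gcongr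
    _ = _ := by ring

/-- If `A'` is too large for `A' ×ˢ A'` to inject into `A + x • A`, then `x` is a quotient of
differences of elements of `A'`. -/
lemma exists_eq_div_of_goodDilate {A' : Finset F} (hA' : A' ⊆ A) (h : GoodDilate A M x)
    (hlt : M * A.card < (A'.card : ℝ) ^ 2) :
    ∃ a ∈ A', ∃ b ∈ A', ∃ c ∈ A', ∃ d ∈ A', c ≠ d ∧ x = (a - b) / (c - d) := by
  have h1 : ((A + x • A).card) < (A' ×ˢ A').card := by
    have : ((A + x • A).card : ℝ) < (A'.card : ℝ) ^ 2 := lt_of_le_of_lt h hlt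
    rw [Finset.card_product, ← sq]
    exact_mod_cast this
  obtain ⟨⟨p1, p2⟩, hp, ⟨q1, q2⟩, hq, hne, e⟩ := Finset.exists_ne_map_eq_of_card_lt_of_maps_to h1
    (f := fun p : F × F => p.1 + x * p.2) (by
      rintro ⟨p1, p2⟩ hp
      simp only [Finset.coe_product, Set.mem_prod, Finset.mem_coe] at hp
      exact Finset.add_mem_add (hA' hp.1) (Finset.smul_mem_smul_finset (hA' hp.2)))
  simp only [Finset.mem_product] at hp hq e
  have h2 : q2 ≠ p2 := by
    rintro rfl
    exact hne (by rw [add_right_cancel e])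
  refine ⟨p1, hp.1, q1, hq.1, q2, hq.2, p2, hp.2, h2, ?_⟩
  rw [eq_div_iff (sub_ne_zero.2 h2)]
  linear_combination -e

/-- There are few good dilation factors. -/
lemma card_le_of_forall_goodDilate (hA : A.Nonempty) {S : Finset F}
    (hS : ∀ x ∈ S, GoodDilate A M x) (hM1 : 1 ≤ M) (hM : 2 * M ≤ A.card) :
    (S.card : ℝ) ≤ 2 * M * A.card := by
  have hn : (0 : ℝ) < A.card := by exact_mod_cast hA.card_pos
  let P := (A ×ˢ A) ×ˢ (A ×ˢ A)
  let T : F → Finset ((F × F) × (F × F)) := fun x =>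
    P.filter fun p => p.1.1 + x * p.1.2 = p.2.1 + x * p.2.2
  let T' : F → Finset ((F × F) × (F × F)) := fun x =>
    (T x).filter fun p => p.1.2 ≠ p.2.2
  have hT : ∀ x ∈ S, (A.card : ℝ) ^ 3 ≤ M * (T x).card := by
    intro x hx
    have h1 := sq_card_le_card_image_mul_card_collisions (A ×ˢ A) (fun p : F × F => p.1 + x * p.2)
    have h2 : ((A ×ˢ A).image (fun p : F × F => p.1 + x * p.2)).card ≤ (A + x • A).card := by
      refine Finset.card_le_card (Finset.image_subset_iff.2 ?_)
      rintro ⟨a, b⟩ hp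
      rw [Finset.mem_product] at hp
      exact Finset.add_mem_add hp.1 (Finset.smul_mem_smul_finset hp.2)
    have h3 : ((A.card : ℝ) * A.card) ^ 2 ≤ (A + x • A).card * (T x).card := by
      rw [Finset.card_product] at h1
      exact_mod_cast h1.trans (Nat.mul_le_mul_right _ h2)
    have h4 : ((A.card : ℝ) * A.card) ^ 2 ≤ (M * A.card) * (T x).card :=
      h3.trans (by gcongr; exact hS x hx)
    refine le_of_mul_le_mul_left ?_ hn
    linarith
  have hTT' : ∀ x, (T x).card ≤ (T' x).card + A.card ^ 2 := by
    intro x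
    rw [← Finset.card_filter_add_card_filter_not (s := T x)
      (fun p : (F × F) × (F × F) => p.1.2 ≠ p.2.2)]
    refine Nat.add_le_add_left ?_ _
    rw [sq, ← Finset.card_product]
    refine Finset.card_le_card_of_injOn (fun p => p.1) ?_ ?_
    · rintro p hp
      simp only [T, P, Finset.coe_filter, Finset.mem_filter, Finset.mem_product,
        Set.mem_ofPred_eq] at hp
      simpa using hp.1.1.1
    · rintro ⟨⟨p1, p2⟩, p3, p4⟩ hp ⟨⟨q1, q2⟩, q3, q4⟩ hq e
      simp only [T, P, Finset.coe_filter, Finset.mem_filter, Finset.mem_product,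
        Set.mem_ofPred_eq, not_not, Prod.mk.injEq] at hp hq e
      obtain ⟨⟨-, e1⟩, rfl⟩ := hp
      obtain ⟨⟨-, e2⟩, rfl⟩ := hq
      obtain ⟨rfl, rfl⟩ := e
      rw [← add_right_cancel e1, ← add_right_cancel e2]
  have hdisj : ∑ x ∈ S, (T' x).card ≤ P.card := by
    rw [← Finset.card_biUnion]
    · refine Finset.card_le_card (Finset.biUnion_subset.2 fun x _ => ?_)
      exact (Finset.filter_subset _ _).trans (Finset.filter_subset _ _)
    · intro x _ y _ hxy
      refine Finset.disjoint_left.2 fun p hp hq => hxy ?_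
      simp only [T', T, Finset.mem_filter] at hp hq
      refine mul_right_cancel₀ (sub_ne_zero.2 hp.2) ?_
      linear_combination hp.1.2 - hq.1.2
  have hlow : ∀ x ∈ S, (A.card : ℝ) ^ 3 ≤ 2 * M * (T' x).card := by
    intro x hx
    have h1 : ((T x).card : ℝ) ≤ (T' x).card + (A.card : ℝ) ^ 2 := by exact_mod_cast hTT' x
    have h2 := hT x hx
    have h3 : M * (T x).card ≤ M * ((T' x).card + (A.card : ℝ) ^ 2) := by gcongr
    have h4 : 2 * M * (A.card : ℝ) ^ 2 ≤ A.card * (A.card : ℝ) ^ 2 := by gcongr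
    nlinarith
  have hsum : (S.card : ℝ) * (A.card : ℝ) ^ 3 ≤ 2 * M * (A.card : ℝ) ^ 4 := by
    calc (S.card : ℝ) * (A.card : ℝ) ^ 3 = ∑ _x ∈ S, (A.card : ℝ) ^ 3 := by
          rw [Finset.sum_const, nsmul_eq_mul]
      _ ≤ ∑ x ∈ S, 2 * M * ((T' x).card : ℝ) := Finset.sum_le_sum hlow
      _ = 2 * M * ∑ x ∈ S, ((T' x).card : ℝ) := by rw [Finset.mul_sum]
      _ ≤ 2 * M * P.card := by
          gcongr
          exact_mod_cast hdisj
      _ = _ := by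
          simp only [P, Finset.card_product]
          push_cast
          ring
  refine le_of_mul_le_mul_right ?_ (pow_pos hn 3)
  linarith

end Dilates

section Cosets

variable {F : Type*} [Field F] [DecidableEq F]

/-- If `B` is a set of non-zero elements on the line `ξ • G`, then any subset of `A` on a parallel
line not passing through the origin has at most `|A * B| / |B|` elements. -/
lemma card_filter_mul_card_le {G : Subfield F} {A B : Finset F} {ξ x : F}
    (hB0 : (0 : F) ∉ B) (hB : ∀ b ∈ B, b / ξ ∈ G) (hξ : ξ ≠ 0)
    {T : Finset F} (hTA : T ⊆ A) (hT : ∀ t ∈ T, t / ξ ∉ G) (hTx : ∀ t ∈ T, (t - x) / ξ ∈ G) :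
    T.card * B.card ≤ (A * B).card := by
  rw [← Finset.card_product]
  refine Finset.card_le_card_of_injOn (fun p => p.1 * p.2) ?_ ?_
  · rintro ⟨t, b⟩ hp
    rw [Finset.mem_coe, Finset.mem_product] at hp
    exact Finset.mul_mem_mul (hTA hp.1) hp.2
  · rintro ⟨t, b⟩ hp ⟨t', b'⟩ hp' e
    rw [Finset.mem_coe, Finset.mem_product] at hp hp'
    simp only at hp hp' e
    have hb : b ≠ 0 := fun h => hB0 (h ▸ hp.2)
    have hb' : b' ≠ 0 := fun h => hB0 (h ▸ hp'.2)
    have hg : b / b' ∈ G := by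
      have := G.div_mem (hB b hp.2) (hB b' hp'.2)
      rwa [div_div_div_cancel_right₀ hξ] at this
    have ht' : t' = t * (b / b') := by
      field_simp
      exact e.symm
    by_cases h1 : b / b' = 1
    · rw [div_eq_one_iff_eq hb'] at h1
      subst h1
      rw [mul_right_cancel₀ hb e]
    · exfalso
      refine hT t hp.1 ?_
      have h2 : (t - t') / ξ ∈ G := by
        have := G.sub_mem (hTx t hp.1) (hTx t' hp'.1)
        rwa [← sub_div, sub_sub_sub_cancel_right] at this
      have h3 : 1 - b / b' ≠ 0 := sub_ne_zero.2 (Ne.symm h1)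
      have h4 : t / ξ = (t - t') / ξ / (1 - b / b') := by
        rw [eq_div_iff h3, ht']
        ring
      rw [h4]
      exact G.div_mem h2 (G.sub_mem G.one_mem hg)

end Cosets

section Structure

variable {F : Type*} [Field F] [DecidableEq F]

/-- The structure theorem for a large set of non-zero elements. -/
lemma exists_subfield_of_small_doubling [Fintype F] {A : Finset F} {K : ℝ} (h0 : (0 : F) ∉ A)
    (hK : 2 ≤ K) (hadd : ((A + A).card : ℝ) ≤ K * A.card) (hmul : ((A * A).card : ℝ) ≤ K * A.card)
    (hlarge : K ^ 69 < A.card) :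
    ∃ G : Subfield F, (Nat.card G : ℝ) ≤ K ^ 31 * A.card ∧ ∃ ξ : F, ξ ≠ 0 ∧
      ∃ X : Finset F, (X.card : ℝ) ≤ K ^ 6 ∧ (A : Set F) ⊆ ξ • (G : Set F) ∪ (X : Set F) := by
  have hK1 : 1 ≤ K := by linarith
  have hK0 : 0 < K := by linarith
  have hn : (0 : ℝ) < A.card := (pow_pos hK0 _).trans hlarge
  have hA : A.Nonempty := Finset.card_pos.1 (by exact_mod_cast hn)
  have hpow : ∀ {m k : ℕ}, m ≤ k → K ^ m ≤ K ^ k := fun h => pow_le_pow_right₀ hK1 h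
  obtain ⟨b, hb, A', hA', hA'card, hpop⟩ := exists_popular_dilate hA h0 hK0 hmul
  have hb0 : b ≠ 0 := fun h => h0 (h ▸ hb)
  have hA'0 : (0 : F) ∉ A' := fun h => h0 (hA' h)
  have hA'K : (A.card : ℝ) ≤ K ^ 2 * A'.card :=
    hA'card.trans (by gcongr; nlinarith)
  have hA'pos : (0 : ℝ) < A'.card := by
    by_contra! h
    nlinarith [pow_pos hK0 2]
  have hgood : ∀ a ∈ A', GoodDilate A (K ^ 4) (a / b) := fun a ha =>
    (goodDilate_div hb0 hA hK0 hadd (hpop a ha)).mono (by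
      have : K ^ 4 = K * K * K ^ 2 := by ring
      rw [this]
      gcongr)
  have hneg := goodDilate_neg_one hA hadd
  have hsub : ∀ c ∈ A', ∀ d ∈ A', GoodDilate A (K ^ 15) ((c - d) / b) := by
    intro c hc d hd
    have h := (hgood c hc).add hA hadd (hneg.mul hA (hgood d hd))
    have e : c / b + -1 * (d / b) = (c - d) / b := by ring
    rw [e] at h
    exact h.mono (le_of_eq (by ring))
  have himprove : ∀ {k : ℕ} {x : F}, k ≤ 65 → GoodDilate A (K ^ k) x →
      GoodDilate A (K ^ 30) x := by
    intro k x hk hx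
    obtain ⟨p, hp, q, hq, r, hr, s, hs, -, rfl⟩ :=
      exists_eq_div_of_goodDilate hA' (hx.mono (hpow hk)) (by
        have h1 : (A.card : ℝ) ^ 2 ≤ (K ^ 2 * A'.card) ^ 2 := by gcongr
        have h2 : K ^ 4 * (K ^ 65 * A.card) < K ^ 4 * (A'.card : ℝ) ^ 2 := by
          calc K ^ 4 * (K ^ 65 * (A.card : ℝ)) = K ^ 69 * A.card := by ring
            _ < (A.card : ℝ) * A.card := by gcongr
            _ = (A.card : ℝ) ^ 2 := by ring
            _ ≤ _ := h1
            _ = _ := by ring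
        exact lt_of_mul_lt_mul_left h2 (by positivity))
    have h := (hsub p hp q hq).mul hA (hsub r hr s hs).inv
    have e : (p - q) / b * ((r - s) / b)⁻¹ = (p - q) / (r - s) := by
      rw [← div_eq_mul_inv, div_div_div_cancel_right₀ hb0]
    rw [e] at h
    exact h.mono (le_of_eq (by ring))
  let G : Subfield F :=
    { carrier := {x | GoodDilate A (K ^ 30) x}
      mul_mem' := fun {x y} hx hy =>
        himprove (k := 60) (by norm_num) ((GoodDilate.mul hA hx hy).mono (le_of_eq (by ring)))
      one_mem' := himprove (k := 1) (by norm_num) (by simpa [GoodDilate] using hadd)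
      add_mem' := fun {x y} hx hy =>
        himprove (k := 65) (by norm_num) ((GoodDilate.add hA hadd hx hy).mono (le_of_eq (by ring)))
      zero_mem' := (goodDilate_zero hA).mono (one_le_pow₀ hK1)
      neg_mem' := fun {x} hx =>
        himprove (k := 32) (by norm_num) (by
          have h := (hneg.mul hA hx).mono (le_of_eq (by ring : _ = K ^ 32))
          rwa [neg_one_mul] at h)
      inv_mem' := fun _ hx => GoodDilate.inv hx }
  have hG : ∀ {x : F}, x ∈ G ↔ GoodDilate A (K ^ 30) x := Iff.rfl
  obtain ⟨ξ, hξ⟩ : A'.Nonempty := Finset.card_pos.1 (by exact_mod_cast hA'pos)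
  have hξ0 : ξ ≠ 0 := fun h => hA'0 (h ▸ hξ)
  have hA'G : ∀ a ∈ A', a / ξ ∈ G := by
    intro a ha
    refine hG.2 (himprove (k := 8) (by norm_num) ?_)
    have h := (hgood a ha).mul hA (hgood ξ hξ).inv
    rw [← div_eq_mul_inv, div_div_div_cancel_right₀ hb0] at h
    exact h.mono (le_of_eq (by ring))
  have hmem : ∀ a : F, a ∈ ξ • (G : Set F) ↔ a / ξ ∈ G := by
    intro a
    rw [Set.mem_smul_set_iff_inv_smul_mem₀ hξ0, smul_eq_mul, mul_comm, ← div_eq_mul_inv]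
    rfl
  refine ⟨G, ?_, ξ, hξ0, ?_⟩
  · classical
    have h := card_le_of_forall_goodDilate hA (S := Finset.univ.filter (· ∈ G)) (M := K ^ 30)
      (fun x hx => hG.1 (Finset.mem_filter.1 hx).2) (one_le_pow₀ hK1) (by
        calc 2 * K ^ 30 ≤ K * K ^ 30 := by gcongr
          _ = K ^ 31 := by ring
          _ ≤ K ^ 69 := hpow (by norm_num)
          _ ≤ _ := hlarge.le)
    have e : Nat.card G = (Finset.univ.filter (· ∈ G)).card := by
      rw [Nat.card_eq_fintype_card]
      exact Fintype.card_subtype _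
    rw [e]
    calc _ ≤ 2 * K ^ 30 * (A.card : ℝ) := h
      _ ≤ K * K ^ 30 * A.card := by gcongr
      _ = _ := by ring
  · classical
    obtain ⟨Y, -, hY, hAY⟩ := Finset.ruzsa_covering_add (A := A) (B := A') (K := K ^ 3) ⟨ξ, hξ⟩ (by
      calc ((A + A').card : ℝ) ≤ (A + A).card := by
            exact_mod_cast Finset.card_le_card (Finset.add_subset_add_left hA')
        _ ≤ K * A.card := hadd
        _ ≤ K * (K ^ 2 * A'.card) := by gcongr
        _ = _ := by ring)
    let X := A.filter (· / ξ ∉ G)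
    refine ⟨X, ?_, ?_⟩
    · have hfib : ∀ y ∈ Y, ((X.filter fun t => (t - y) / ξ ∈ G).card : ℝ) ≤ K ^ 3 := by
        intro y _
        have h1 := card_filter_mul_card_le (G := G) (A := A) (x := y) hA'0 hA'G hξ0
          (T := X.filter fun t => (t - y) / ξ ∈ G)
          ((Finset.filter_subset _ _).trans (Finset.filter_subset _ _))
          (fun t ht => (Finset.mem_filter.1 (Finset.mem_filter.1 ht).1).2)
          (fun t ht => (Finset.mem_filter.1 ht).2)
        have h2 := h1.trans (Finset.card_le_card (Finset.mul_subset_mul_left hA'))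
        refine le_of_mul_le_mul_right ?_ hA'pos
        calc _ ≤ ((A * A).card : ℝ) := by exact_mod_cast h2
          _ ≤ K * A.card := hmul
          _ ≤ K * (K ^ 2 * A'.card) := by gcongr
          _ = _ := by ring
      have hcov : X ⊆ Y.biUnion fun y => X.filter fun t => (t - y) / ξ ∈ G := by
        intro t ht
        obtain ⟨y, hy, z, hz, rfl⟩ := Finset.mem_add.1 (hAY (Finset.mem_filter.1 ht).1)
        obtain ⟨u, hu, v, hv, rfl⟩ := Finset.mem_sub.1 hz
        refine Finset.mem_biUnion.2 ⟨y, hy, Finset.mem_filter.2 ⟨ht, ?_⟩⟩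
        rw [add_sub_cancel_left, sub_div]
        exact G.sub_mem (hA'G u hu) (hA'G v hv)
      calc (X.card : ℝ) ≤ ∑ y ∈ Y, ((X.filter fun t => (t - y) / ξ ∈ G).card : ℝ) := by
            exact_mod_cast (Finset.card_le_card hcov).trans Finset.card_biUnion_le
        _ ≤ ∑ _y ∈ Y, K ^ 3 := Finset.sum_le_sum hfib
        _ = Y.card * K ^ 3 := by rw [Finset.sum_const, nsmul_eq_mul]
        _ ≤ K ^ 3 * K ^ 3 := by gcongr
        _ = _ := by ring
    · intro a ha
      by_cases h : a / ξ ∈ G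
      · exact Or.inl ((hmem a).2 h)
      · exact Or.inr (Finset.mem_coe.2 (Finset.mem_filter.2 ⟨ha, h⟩))

end Structure

theorem general_finite_field_structure :
    ∀ δ : ℝ, 0 < δ → δ < 1 →
      ∃ C : ℝ, 0 < C ∧
        ∀ (F : Type*) [Field F] [Fintype F] [DecidableEq F] (A : Finset F),
          (Fintype.card F : ℝ) ^ δ < (A.card : ℝ) →
          ∀ K : ℝ, 2 ≤ K →
            ((A + A).card : ℝ) ≤ K * A.card →
            ((A * A).card : ℝ) ≤ K * A.card →
            ∃ G : Subfield F, (Nat.card G : ℝ) ≤ K ^ C * A.card ∧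
              ∃ ξ : F, ξ ≠ 0 ∧
                ∃ X : Finset F, (X.card : ℝ) ≤ K ^ C ∧
                  (A : Set F) ⊆ ξ • (G : Set F) ∪ (X : Set F) := by
  intro δ hδ hδ1
  have hC : (139 : ℝ) ≤ 139 / δ := by
    rw [le_div_iff₀ hδ]
    linarith
  refine ⟨139 / δ, by positivity, ?_⟩
  intro F _ _ _ A hcard K hK hadd hmul
  have hK1 : 1 ≤ K := by linarith
  have hK0 : 0 < K := by linarith
  have hpow : ∀ {m : ℕ}, m ≤ 139 → K ^ m ≤ K ^ (139 / δ) := by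
    intro m hm
    rw [← Real.rpow_natCast]
    refine Real.rpow_le_rpow_of_exponent_le hK1 (le_trans ?_ hC)
    exact_mod_cast hm
  by_cases hsmall : (A.card : ℝ) ≤ K ^ 139
  · refine ⟨⊤, ?_, 1, one_ne_zero, ∅, ?_, ?_⟩
    · have hA1 : (1 : ℝ) ≤ A.card := by
        have : (0 : ℝ) < A.card :=
          lt_of_le_of_lt (Real.rpow_nonneg (Nat.cast_nonneg _) _) hcard
        exact_mod_cast this
      have h1 : (Fintype.card F : ℝ) ≤ K ^ (139 / δ) := by
        have h2 : (Fintype.card F : ℝ) ^ δ ≤ (K ^ (139 / δ)) ^ δ := by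
          rw [← Real.rpow_mul hK0.le, div_mul_cancel₀ _ hδ.ne']
          refine hcard.le.trans (hsmall.trans (le_of_eq ?_))
          exact_mod_cast (Real.rpow_natCast K 139).symm
        exact (Real.rpow_le_rpow_iff (Nat.cast_nonneg _) (by positivity) hδ).1 h2
      have e : Nat.card (⊤ : Subfield F) = Fintype.card F := by
        rw [← Nat.card_eq_fintype_card]
        exact Nat.card_congr Subfield.topEquiv.toEquiv
      rw [e]
      exact h1.trans (le_mul_of_one_le_right (by positivity) hA1)
    · simp only [Finset.card_empty, Nat.cast_zero]
      positivity
    · intro a _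
      left
      simp
  · push Not at hsmall
    set B := A.erase 0
    have hBA : B ⊆ A := Finset.erase_subset _ _
    have hBcard : (A.card : ℝ) ≤ B.card + 1 := by
      have : A.card - 1 ≤ B.card := Finset.pred_card_le_card_erase (s := A) (a := 0)
      exact_mod_cast (by omega : A.card ≤ B.card + 1)
    have h2 : 2 * K ^ 138 ≤ K ^ 139 := by
      calc 2 * K ^ 138 ≤ K * K ^ 138 := by gcongr
        _ = _ := by ring
    have h1 : 1 ≤ K ^ 138 := one_le_pow₀ hK1
    have hBlarge : (K ^ 2) ^ 69 < (B.card : ℝ) := by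
      rw [← pow_mul]
      norm_num
      linarith
    have hKB : K * A.card ≤ K ^ 2 * B.card := by
      have : (A.card : ℝ) ≤ K * B.card := by nlinarith
      calc K * A.card ≤ K * (K * B.card) := by gcongr
        _ = _ := by ring
    have hBadd : ((B + B).card : ℝ) ≤ K ^ 2 * B.card := by
      refine le_trans ?_ (hadd.trans hKB)
      exact_mod_cast Finset.card_le_card (Finset.add_subset_add hBA hBA)
    have hBmul : ((B * B).card : ℝ) ≤ K ^ 2 * B.card := by
      refine le_trans ?_ (hmul.trans hKB)
      exact_mod_cast Finset.card_le_card (Finset.mul_subset_mul hBA hBA)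
    obtain ⟨G, hG, ξ, hξ, X, hX, hBX⟩ := exists_subfield_of_small_doubling
      (Finset.notMem_erase 0 A) (by nlinarith : 2 ≤ K ^ 2) hBadd hBmul hBlarge
    rw [← pow_mul] at hG hX
    refine ⟨G, ?_, ξ, hξ, X, hX.trans (hpow (by norm_num)), ?_⟩
    · refine hG.trans ?_
      gcongr
      exact hpow (by norm_num)
    · intro a ha
      by_cases ha0 : a = 0
      · exact Or.inl ⟨0, G.zero_mem, by simp [ha0]⟩
      · exact hBX (Finset.mem_coe.2 (Finset.mem_erase.2 ⟨ha0, ha⟩))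
end

section
/- Let A and B be finite sets, let R ⊆ A × B be a relation, and let X be a real number with |R| ≥ X and X ≥ 4·|B|. Then |{(a, a', b) ∈ A × A × B : a ≠ a', (a,b) ∈ R, (a',b) ∈ R}| ≥ X²/(8·|B|). -/
/-- The size of a relation is the sum of the sizes of its fibres over the second coordinate. -/
theorem card_eq_sum_card_relation_fibers {α β : Type*} [DecidableEq α] [DecidableEq β]
    (A : Finset α) (B : Finset β) (R : Finset (α × β)) (hR : R ⊆ A ×ˢ B) :
    R.card = ∑ b ∈ B, (A.filter fun a => (a, b) ∈ R).card := by
  rw [Finset.card_eq_sum_card_fiberwise (f := Prod.snd) (t := B)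
    fun p hp => (Finset.mem_product.1 (hR hp)).2]
  refine Finset.sum_congr rfl fun b _ => ?_
  refine Finset.card_bij' (fun p _ => p.1) (fun a _ => (a, b)) ?_ ?_ ?_ ?_
  · rintro ⟨a, c⟩ h
    obtain ⟨hac, rfl⟩ := Finset.mem_filter.1 h
    exact Finset.mem_filter.2 ⟨(Finset.mem_product.1 (hR hac)).1, hac⟩
  · intro a h
    exact Finset.mem_filter.2 ⟨(Finset.mem_filter.1 h).2, rfl⟩
  · rintro ⟨a, c⟩ h
    obtain ⟨_, rfl⟩ := Finset.mem_filter.1 h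
    rfl
  · intro a h
    rfl

/-- Pairs of distinct points related to a common point, counted by that common point. -/
theorem card_collisions_eq_sum_card_offDiag {α β : Type*} [DecidableEq α] [DecidableEq β]
    (A : Finset α) (B : Finset β) (R : Finset (α × β)) :
    ((A ×ˢ A ×ˢ B).filter fun t =>
        t.1 ≠ t.2.1 ∧ (t.1, t.2.2) ∈ R ∧ (t.2.1, t.2.2) ∈ R).card =
      ∑ b ∈ B, (A.filter fun a => (a, b) ∈ R).offDiag.card := by
  rw [Finset.card_eq_sum_card_fiberwise (f := fun t : α × α × β => t.2.2) (t := B)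
    fun t ht => by
      have := (Finset.mem_filter.1 ht).1
      simp only [Finset.mem_product] at this
      exact this.2.2]
  refine Finset.sum_congr rfl fun b hb => ?_
  refine Finset.card_bij' (fun t _ => (t.1, t.2.1)) (fun p _ => (p.1, p.2, b)) ?_ ?_ ?_ ?_
  · rintro ⟨a, a', c⟩ h
    simp only [Finset.mem_filter, Finset.mem_product, Finset.mem_offDiag] at h ⊢
    obtain ⟨h, rfl⟩ := h
    tauto
  · rintro ⟨a, a'⟩ h
    simp only [Finset.mem_filter, Finset.mem_product, Finset.mem_offDiag] at h ⊢
    tauto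
  · rintro ⟨a, a', c⟩ h
    obtain ⟨_, rfl⟩ := Finset.mem_filter.1 h
    rfl
  · intro p _
    rfl

theorem cauchy_schwarz_relation {α β : Type*} [DecidableEq α] [DecidableEq β]
    (A : Finset α) (B : Finset β) (R : Finset (α × β)) (hR : R ⊆ A ×ˢ B)
    (X : ℝ) (hX : X ≤ (R.card : ℝ)) (hXB : 4 * (B.card : ℝ) ≤ X) :
    X ^ 2 / (8 * (B.card : ℝ)) ≤
      (((A ×ˢ A ×ˢ B).filter fun t =>
          t.1 ≠ t.2.1 ∧ (t.1, t.2.2) ∈ R ∧ (t.2.1, t.2.2) ∈ R).card : ℝ) := by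
  rcases B.eq_empty_or_nonempty with rfl | hB
  · simp
  have hBpos : (0 : ℝ) < B.card := by exact_mod_cast hB.card_pos
  rw [card_collisions_eq_sum_card_offDiag]
  set d : β → ℕ := fun b => (A.filter fun a => (a, b) ∈ R).card
  have hsum : (R.card : ℝ) = ∑ b ∈ B, (d b : ℝ) := by
    exact_mod_cast card_eq_sum_card_relation_fibers A B R hR
  have hoff : ((∑ b ∈ B, (A.filter fun a => (a, b) ∈ R).offDiag.card : ℕ) : ℝ) =
      ∑ b ∈ B, (d b : ℝ) ^ 2 - R.card := by
    rw [hsum, ← Finset.sum_sub_distrib, Nat.cast_sum]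
    refine Finset.sum_congr rfl fun b _ => ?_
    rw [Finset.offDiag_card, Nat.cast_sub (Nat.le_mul_self _), Nat.cast_mul, sq]
  have hcs : (R.card : ℝ) ^ 2 ≤ B.card * ∑ b ∈ B, (d b : ℝ) ^ 2 := by
    rw [hsum]
    exact sq_sum_le_card_mul_sum_sq
  rw [hoff, div_le_iff₀ (by positivity)]
  have hXR : X ^ 2 ≤ (R.card : ℝ) ^ 2 := pow_le_pow_left₀ (by linarith) hX 2
  have hBR : 4 * (B.card : ℝ) * R.card ≤ (R.card : ℝ) * R.card :=
    mul_le_mul_of_nonneg_right (by linarith) (by positivity)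
  nlinarith
end

section
/- Let F be a field, let P be a finite set of points in F², and let L be a finite set of lines in F² (a line being a set of the form {p + t·v : t ∈ F} for some p ∈ F² and non-zero v ∈ F²). Then the number of incidences satisfies |{(p, l) ∈ P × L : p ∈ l}| ≤ 2·(|P|^{1/2}·|L| + |P|). -/
/-- A line in the plane `F²`: the set `{p + t • v : t ∈ F}` for some point `p`
and some non-zero direction `v`. -/
def IsPlaneLine (F : Type*) [Field F] (l : Set (F × F)) : Prop :=
  ∃ p v : F × F, v ≠ 0 ∧ l = {x | ∃ t : F, x = p + t • v}

/-- Two distinct lines meet in at most one point: two distinct common points force equality. -/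
theorem IsPlaneLine.eq_of_mem {F : Type*} [Field F] {l m : Set (F × F)} (hl : IsPlaneLine F l)
    (hm : IsPlaneLine F m) {x y : F × F} (hxy : x ≠ y) (hxl : x ∈ l) (hyl : y ∈ l) (hxm : x ∈ m)
    (hym : y ∈ m) : l = m := by
  suffices key : ∀ k : Set (F × F), IsPlaneLine F k → x ∈ k → y ∈ k →
      k = {z | ∃ t : F, z = x + t • (y - x)} by
    rw [key l hl hxl hyl, key m hm hxm hym]
  rintro k ⟨p, v, -, rfl⟩ ⟨a, rfl⟩ ⟨b, rfl⟩
  have hab : b - a ≠ 0 := by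
    intro h
    exact hxy (by rw [sub_eq_zero.mp h])
  have hdir : p + b • v - (p + a • v) = (b - a) • v := by module
  ext z
  simp only [Set.mem_ofPred_eq, hdir, smul_smul]
  constructor
  · rintro ⟨t, rfl⟩
    refine ⟨(t - a) / (b - a), ?_⟩
    rw [div_mul_cancel₀ _ hab]
    module
  · rintro ⟨t, rfl⟩
    exact ⟨a + t * (b - a), by module⟩

open Classical in
/-- The Cauchy–Schwarz incidence inequality: if any two distinct members of `L` have at most one
common incident element of `P`, then the number `I` of incidences satisfies
`I² ≤ |P| (I + |L|²)`. -/
theorem sq_sum_card_incident_le {α β : Type*} (r : α → β → Prop) (P : Finset α) (L : Finset β)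
    (h : ∀ l ∈ L, ∀ m ∈ L, l ≠ m → ∀ x ∈ P, ∀ y ∈ P, r x l → r x m → r y l → r y m → x = y) :
    (∑ p ∈ P, (L.filter (r p)).card) ^ 2 ≤
      P.card * (∑ p ∈ P, (L.filter (r p)).card + L.card ^ 2) := by
  refine sq_sum_le_card_mul_sum_sq.trans (Nat.mul_le_mul_left _ ?_)
  have hcount : ∑ p ∈ P, (L.filter (r p)).card ^ 2 =
      ∑ l ∈ L, ∑ m ∈ L, (P.filter fun p => r p l ∧ r p m).card := by
    simp only [Finset.card_filter, sq, Finset.sum_mul_sum]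
    rw [Finset.sum_comm]
    refine Finset.sum_congr rfl fun l _ => ?_
    rw [Finset.sum_comm]
    refine Finset.sum_congr rfl fun m _ => Finset.sum_congr rfl fun p _ => ?_
    by_cases hl : r p l <;> by_cases hm : r p m <;> simp [hl, hm]
  have hpair : ∀ l ∈ L, ∀ m ∈ L, (P.filter fun p => r p l ∧ r p m).card ≤
      (if l = m then (P.filter fun p => r p l).card else 0) + 1 := by
    intro l hl m hm
    by_cases hlm : l = m
    · subst hlm
      simp
    · simp only [hlm, if_false, zero_add]
      refine Finset.card_le_one.mpr fun x hx y hy => ?_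
      simp only [Finset.mem_filter] at hx hy
      exact h l hl m hm hlm x hx.1 y hy.1 hx.2.1 hx.2.2 hy.2.1 hy.2.2
  have hdual : ∑ p ∈ P, (L.filter (r p)).card = ∑ l ∈ L, (P.filter fun p => r p l).card := by
    simp only [Finset.card_filter]
    exact Finset.sum_comm
  rw [hcount, hdual]
  refine (Finset.sum_le_sum fun l hl => Finset.sum_le_sum (hpair l hl)).trans (le_of_eq ?_)
  simp +contextual [Finset.sum_add_distrib, sq]

open Classical in
/-- The set of incident pairs is counted point by point. -/
theorem ncard_incidences {α β : Type*} (r : α → β → Prop) (P : Finset α) (L : Finset β) :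
    {pl : α × β | pl.1 ∈ P ∧ pl.2 ∈ L ∧ r pl.1 pl.2}.ncard =
      ∑ p ∈ P, (L.filter (r p)).card := by
  have hset : {pl : α × β | pl.1 ∈ P ∧ pl.2 ∈ L ∧ r pl.1 pl.2} =
      ((P ×ˢ L).filter fun pl => r pl.1 pl.2 : Finset (α × β)) := by
    ext
    simp [and_assoc]
  rw [hset, Set.ncard_coe_finset, Finset.card_filter, Finset.sum_product]
  simp only [Finset.card_filter]

/-- Solving the quadratic inequality `I² ≤ n (I + k²)` for `I`. -/
theorem le_sqrt_mul_add_of_sq_le {I n k : ℝ} (hn : 0 ≤ n) (hk : 0 ≤ k)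
    (h : I ^ 2 ≤ n * (I + k ^ 2)) : I ≤ √n * k + n := by
  have hb : 0 ≤ √n * k := by positivity
  have hsq : (√n * k) ^ 2 = n * k ^ 2 := by rw [mul_pow, Real.sq_sqrt hn]
  by_contra! hI
  nlinarith

theorem easy_incidence_bound {F : Type*} [Field F]
    (P : Finset (F × F)) (L : Finset (Set (F × F))) (hL : ∀ l ∈ L, IsPlaneLine F l) :
    ({pl : (F × F) × Set (F × F) | pl.1 ∈ P ∧ pl.2 ∈ L ∧ pl.1 ∈ pl.2}.ncard : ℝ)
      ≤ 2 * (Real.sqrt P.card * L.card + P.card) := by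
  classical
  have hsq := sq_sum_card_incident_le (fun (p : F × F) (l : Set (F × F)) => p ∈ l) P L
    fun l hl m hm hlm x _ y _ hxl hxm hyl hym => by
      by_contra hxy
      exact hlm ((hL l hl).eq_of_mem (hL m hm) hxy hxl hyl hxm hym)
  rw [← ncard_incidences] at hsq
  have hbound := le_sqrt_mul_add_of_sq_le
    (I := {pl : (F × F) × Set (F × F) | pl.1 ∈ P ∧ pl.2 ∈ L ∧ pl.1 ∈ pl.2}.ncard)
    (Nat.cast_nonneg P.card) (Nat.cast_nonneg L.card)
    (by exact_mod_cast hsq)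
  have hnonneg : 0 ≤ √(P.card : ℝ) * L.card + P.card := by positivity
  linarith
end
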